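/- Let F = ℚ(√d) with d ≥ 6 squarefree. If Nm_{F/ℚ}(ε) = 1 and H = (−ε,−3/F), let 𝒪₃‡ = O_F[i, (1+j)/2] be the O_F-order with O_F-basis 1, i, (1+j)/2, (i+k)/2. Then t(H, D₃‡) + t(H, S₄) + t(H, D₆) = ℶ(𝒪₃‡). If Nm_{F/ℚ}(ε) = −1, or if H is a totally definite quaternion F-algebra not F-isomorphic to (−ε,−3/F), then t(H, D₃‡) = 0. -/

import Mathlib

open NumberField Quaternion

noncomputable section

namespace QuatPaper

variable (F : Type) [Field F] [NumberField F]

def scalarSet (H : Type) [Ring H] [Algebra F H] : Set H :=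
  Set.range fun r : 𝓞 F => algebraMap F H (algebraMap (𝓞 F) F r)

def IsOrder {H : Type} [Ring H] [Algebra F H] (O : Subring H) : Prop :=
  scalarSet F H ⊆ ↑O ∧ O.toAddSubgroup.FG ∧ Submodule.span F (O : Set H) = ⊤

def IsMaximalOrder {H : Type} [Ring H] [Algebra F H] (O : Subring H) : Prop :=
  IsOrder F O ∧ ∀ O' : Subring H, IsOrder F O' → O ≤ O' → O' = O

def IsScalarUnit {H : Type} [Ring H] [Algebra F H] {O : Subring H} (u : (↥O)ˣ) : Prop :=
  ∃ r : (𝓞 F)ˣ, ((u : ↥O) : H) = algebraMap F H (algebraMap (𝓞 F) F ↑r)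

def RedUnitIso {H : Type} [Ring H] [Algebra F H] (O : Subring H) (G : Type*) [Group G] : Prop :=
  ∃ φ : (↥O)ˣ →* G, Function.Surjective φ ∧ ∀ u, φ u = 1 ↔ IsScalarUnit F u

def IsConjugate {H : Type} [Ring H] (x : Hˣ) (O O' : Subring H) : Prop :=
  ∀ y : H, y ∈ O ↔ (x : H) * y * ((x⁻¹ : Hˣ) : H) ∈ O'

def ConjRel {H : Type} [Ring H] (O O' : Subring H) : Prop :=
  ∃ x : Hˣ, IsConjugate x O O'

def typeNum (H : Type) [Ring H] [Algebra F H] (G : Type*) [Group G] : ℕ :=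
  Nat.card (Quot fun O O' : {O : Subring H // IsMaximalOrder F O ∧ RedUnitIso F O G} =>
    ConjRel O.1 O'.1)

def IsQuatAlg (H : Type) [Ring H] [Algebra F H] : Prop :=
  ∃ a b : F, a ≠ 0 ∧ b ≠ 0 ∧ Nonempty (H ≃ₐ[F] ℍ[F, a, b])

def TotallyDefinite (H : Type) [Ring H] [Algebra F H] : Prop :=
  ∀ σ : F →+* ℝ,
    letI : Algebra F ℝ := σ.toAlgebra
    ∀ x : TensorProduct F ℝ H, x ≠ 0 → IsUnit x

/-- The reduced norm `Nr(x) = x·x̄` of a quaternion `x ∈ ℍ[F, A, B]`. -/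
def redNorm {A B : F} (x : ℍ[F, A, B]) : F := (x * star x).re

/-- The reduced unit group of `O` is isomorphic to the dihedral group `D_n` and is
of the *first kind*: every element of order `2` in `O^×/O_F^×` admits a representative
whose reduced norm is the square of a unit of `O_F`. -/
def RedUnitDihedralFirstKind {A B : F} (n : ℕ) (O : Subring ℍ[F, A, B]) : Prop :=
  ∃ φ : (↥O)ˣ →* DihedralGroup n, Function.Surjective φ ∧
    (∀ u, φ u = 1 ↔ IsScalarUnit F u) ∧
    ∀ u : (↥O)ˣ, φ u ≠ 1 → φ u * φ u = 1 →
      ∃ u' : (↥O)ˣ, φ u' = φ u ∧ ∃ r : (𝓞 F)ˣ,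
        redNorm F ((u' : ↥O) : ℍ[F, A, B]) = algebraMap (𝓞 F) F ↑r ^ 2

/-- The reduced unit group of `O` is isomorphic to the dihedral group `D_n` and is
of the *second kind*: some element of order `2` in `O^×/O_F^×` has no representative
whose reduced norm is the square of a unit of `O_F`. -/
def RedUnitDihedralSecondKind {A B : F} (n : ℕ) (O : Subring ℍ[F, A, B]) : Prop :=
  ∃ φ : (↥O)ˣ →* DihedralGroup n, Function.Surjective φ ∧
    (∀ u, φ u = 1 ↔ IsScalarUnit F u) ∧
    ∃ u : (↥O)ˣ, φ u ≠ 1 ∧ φ u * φ u = 1 ∧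
      ∀ u' : (↥O)ˣ, φ u' = φ u → ∀ r : (𝓞 F)ˣ,
        redNorm F ((u' : ↥O) : ℍ[F, A, B]) ≠ algebraMap (𝓞 F) F ↑r ^ 2

/-- `t(H, D_n†)`: the number of conjugacy classes of maximal orders whose reduced unit
group is isomorphic to `D_n` of the first kind. -/
def typeNumDnFirstKind (A B : F) (n : ℕ) : ℕ :=
  Nat.card (Quot fun O O' : {O : Subring ℍ[F, A, B] //
      IsMaximalOrder F O ∧ RedUnitDihedralFirstKind F n O} => ConjRel O.1 O'.1)

/-- `t(H, D_n‡)`: the number of conjugacy classes of maximal orders whose reduced unit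
group is isomorphic to `D_n` of the second kind. -/
def typeNumDnSecondKind (A B : F) (n : ℕ) : ℕ :=
  Nat.card (Quot fun O O' : {O : Subring ℍ[F, A, B] //
      IsMaximalOrder F O ∧ RedUnitDihedralSecondKind F n O} => ConjRel O.1 O'.1)

/-- `ℵ(O₀)`: the number of maximal orders containing `O₀`. -/
def alephNum {H : Type} [Ring H] [Algebra F H] (O₀ : Subring H) : ℕ :=
  Nat.card {O : Subring H // IsMaximalOrder F O ∧ O₀ ≤ O}

/-- `ℶ(O₀)`: the number of orbits of the conjugation action of the normalizer
`N(O₀)` on the set of maximal orders containing `O₀`. -/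
def bethNum {H : Type} [Ring H] [Algebra F H] (O₀ : Subring H) : ℕ :=
  Nat.card (Quot fun O O' : {O : Subring H // IsMaximalOrder F O ∧ O₀ ≤ O} =>
    ∃ x : Hˣ, IsConjugate x O₀ O₀ ∧ IsConjugate x O.1 O'.1)

section RealQuadratic

variable {F : Type} [Field F] [NumberField F]

/-- The `ℚ`-linear map `(p, q) ↦ p + q s`. -/
def ratPairMap (s : F) : (Fin 2 → ℚ) →ₗ[ℚ] F where
  toFun v := (v 0 : F) + (v 1 : F) * s
  map_add' v w := by simp; ring
  map_smul' c v := by simp [Algebra.smul_def]; ring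

lemma natCast_ne_rat_sq {d : ℕ} (hd : 2 ≤ d) (hsf : Squarefree d) (q : ℚ) : q ^ 2 ≠ d := by
  intro h
  have h1 : IsSquare (d : ℚ) := ⟨q, by rw [← h, sq]⟩
  rw [Rat.isSquare_natCast_iff] at h1
  obtain ⟨m, hm⟩ := h1
  have := hsf m ⟨1, by simp [hm]⟩
  rw [Nat.isUnit_iff] at this
  subst this; omega

/-- `F = ℚ(s)` with `s² = d` for a squarefree `d ≥ 6`. -/
structure IsRealQuadratic (d : ℕ) (s : F) : Prop where
  six_le : 6 ≤ d
  squarefree : Squarefree d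
  sq_eq : s ^ 2 = (d : F)
  adjoin_eq_top : Algebra.adjoin ℚ {s} = ⊤

variable {d : ℕ} {s : F}

lemma IsRealQuadratic.ratPairMap_bijective (h : IsRealQuadratic d s) :
    Function.Bijective (ratPairMap s) := by
  obtain ⟨hd, hsf, hs, hgen⟩ := h
  constructor
  · rw [← LinearMap.ker_eq_bot, LinearMap.ker_eq_bot']
    intro v hv
    change (v 0 : F) + (v 1 : F) * s = 0 at hv
    have h1 : v 1 = 0 := by
      by_contra h
      have h' : (v 1 : F) ≠ 0 := by exact_mod_cast h
      have : s = ((-(v 0) / v 1 : ℚ) : F) := by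
        push_cast; field_simp; linear_combination hv
      apply natCast_ne_rat_sq (by omega) hsf (-(v 0) / v 1)
      have h2 : (((-(v 0) / v 1 : ℚ) : F)) ^ 2 = d := by rw [← this, hs]
      exact_mod_cast h2
    have h0 : v 0 = 0 := by
      rw [h1] at hv; simpa using hv
    ext i; fin_cases i <;> simp [h0, h1]
  · intro x
    have hx : x ∈ Algebra.adjoin ℚ {s} := by rw [hgen]; trivial
    induction hx using Algebra.adjoin_induction with
    | mem x hx => exact ⟨![0, 1], by simp [ratPairMap, Set.mem_singleton_iff.mp hx]⟩
    | algebraMap r => exact ⟨![r, 0], by simp [ratPairMap]⟩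
    | add x y _ _ hx hy =>
      obtain ⟨v, rfl⟩ := hx
      obtain ⟨w, rfl⟩ := hy
      exact ⟨v + w, map_add _ _ _⟩
    | mul x y _ _ hx hy =>
      obtain ⟨v, rfl⟩ := hx
      obtain ⟨w, rfl⟩ := hy
      refine ⟨![v 0 * w 0 + d * (v 1 * w 1), v 0 * w 1 + v 1 * w 0], ?_⟩
      simp [ratPairMap]
      linear_combination -(v 1 : F) * w 1 * hs

lemma IsRealQuadratic.exists_rat_pair (h : IsRealQuadratic d s) (x : F) :
    ∃ p q : ℚ, x = p + q * s := by
  obtain ⟨v, rfl⟩ := h.ratPairMap_bijective.2 x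
  exact ⟨v 0, v 1, rfl⟩

lemma IsRealQuadratic.rat_pair_unique (H : IsRealQuadratic d s)
    {p q p' q' : ℚ} (h : (p : F) + q * s = p' + q' * s) :
    p = p' ∧ q = q' := by
  have := H.ratPairMap_bijective.1 (a₁ := ![p, q]) (a₂ := ![p', q'])
    (by simpa [ratPairMap] using h)
  exact ⟨by simpa using congrFun this 0, by simpa using congrFun this 1⟩

lemma IsRealQuadratic.exists_conj (h : IsRealQuadratic d s) : ∃ τ : F →+* F, τ s = -s := by
  choose p q hpq using h.exists_rat_pair
  have hs := h.sq_eq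
  have key : ∀ (x : F) (a b : ℚ), x = a + b * s → (p x : F) - q x * s = a - b * s := by
    intro x a b hx
    obtain ⟨h1, h2⟩ := h.rat_pair_unique ((hpq x).symm.trans hx)
    rw [h1, h2]
  refine ⟨⟨⟨⟨fun x => p x - q x * s, ?_⟩, ?_⟩, ?_, ?_⟩, ?_⟩
  · simpa using key 1 1 0 (by simp)
  · intro x y
    refine (key (x * y) (p x * p y + d * (q x * q y)) (p x * q y + q x * p y) ?_).trans ?_
    · conv_lhs => rw [hpq x, hpq y]
      push_cast; linear_combination (q x : F) * q y * hs
    · push_cast; linear_combination -(q x : F) * q y * hs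
  · simpa using key 0 0 0 (by simp)
  · intro x y
    refine (key (x + y) (p x + p y) (q x + q y) ?_).trans ?_
    · conv_lhs => rw [hpq x, hpq y]
      push_cast; ring
    · push_cast; ring
  · simpa using key s 0 1 (by simp)

lemma IsRealQuadratic.norm_rat_pair (h : IsRealQuadratic d s) (p q : ℚ) :
    Algebra.norm ℚ ((p : F) + q * s) = p ^ 2 - d * q ^ 2 := by
  have hs := h.sq_eq
  let e := LinearEquiv.ofBijective _ h.ratPairMap_bijective
  let b := Module.Basis.ofEquivFun e.symm
  have he : ∀ v, e v = (v 0 : F) + v 1 * s := fun v => rfl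
  have hb : ∀ (x : F) (a c : ℚ), x = a + c * s → ∀ i, b.repr x i = ![a, c] i := by
    intro x a c hx i
    have : x = e ![a, c] := by rw [he, hx]; simp
    rw [this]; simp [b]
  have hb0 : b 0 = 1 := by simp [b, he]
  have hb1 : b 1 = s := by simp [b, he]
  rw [Algebra.norm_eq_matrix_det b, Matrix.det_fin_two]
  simp only [Algebra.leftMulMatrix_eq_repr_mul, hb0, hb1, mul_one]
  rw [hb _ p q rfl, hb _ p q rfl,
    hb _ (d * q) p (by push_cast; linear_combination (q : F) * hs),
    hb _ (d * q) p (by push_cast; linear_combination (q : F) * hs)]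
  simp; ring

lemma IsRealQuadratic.sq_ne_natCast (h : IsRealQuadratic d s) (n : ℕ) (hn : Squarefree n)
    (hn2 : 2 ≤ n) (hnd : n < d) (x : F) : x ^ 2 ≠ n := by
  obtain ⟨p, q, rfl⟩ := h.exists_rat_pair x
  intro hx
  have h1 := h.rat_pair_unique (p := p ^ 2 + d * q ^ 2) (q := 2 * p * q) (p' := n) (q' := 0)
    (by push_cast; linear_combination hx - (q : F) ^ 2 * h.sq_eq)
  obtain ⟨h1, h2⟩ := h1
  have h3 : p = 0 ∨ q = 0 := by simpa using h2
  rcases h3 with rfl | rfl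
  · have h4 : (d : ℚ) * q ^ 2 = n := by linear_combination h1
    have hd0 : (d : ℚ) ≠ 0 := by
      have := h.six_le
      exact_mod_cast (by omega : d ≠ 0)
    have h5 : IsSquare ((d * n : ℕ) : ℚ) := ⟨d * q, by push_cast; rw [← h4]; ring⟩
    rw [Rat.isSquare_natCast_iff] at h5
    have h6 : d = n := by
      have hdn : ∀ a b : ℕ, Squarefree a → IsSquare (a * b) → a ∣ b := by
        rintro a b ha ⟨m, hm⟩
        have h7 : a ∣ m := (ha.dvd_pow_iff_dvd two_ne_zero).1 ⟨b, by rw [hm, sq]⟩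
        obtain ⟨c, rfl⟩ := h7
        have ha0 : 0 < a := Nat.pos_of_ne_zero ha.ne_zero
        refine ⟨c ^ 2, Nat.eq_of_mul_eq_mul_left ha0 (by rw [hm]; ring)⟩
      exact Nat.dvd_antisymm (hdn d n h.squarefree h5) (hdn n d hn (by rwa [mul_comm]))
    omega
  · exact natCast_ne_rat_sq hn2 hn p (by linear_combination h1)

lemma IsRealQuadratic.exists_int_eq (h : IsRealQuadratic d s) (σ₀ σ₁ : F →+* ℝ)
    (hσ : σ₁ s = -σ₀ s) {t : F} (ht : IsIntegral ℤ t) (h0 : |σ₀ t| ≤ 2) (h1 : |σ₁ t| ≤ 2) :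
    ∃ n : ℤ, t = n ∧ -2 ≤ n ∧ n ≤ 2 := by
  obtain ⟨τ, hτ⟩ := h.exists_conj
  obtain ⟨p, q, rfl⟩ := h.exists_rat_pair t
  have ht' : IsIntegral ℤ ((p : F) - q * s) := by
    have := ht.map (τ.toIntAlgHom)
    simpa [hτ, ← sub_eq_add_neg] using this
  have exists_int : ∀ r : ℚ, IsIntegral ℤ (r : F) → ∃ m : ℤ, r = m := by
    intro r hr
    have h2 : IsIntegral ℤ r :=
      (isIntegral_algHom_iff ((algebraMap ℚ F).toIntAlgHom) (algebraMap ℚ F).injective).1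
        (by simpa using hr)
    obtain ⟨m, hm⟩ := IsIntegrallyClosed.isIntegral_iff.1 h2
    exact ⟨m, by simpa using hm.symm⟩
  obtain ⟨a, ha⟩ := exists_int (2 * p) (by
    rw [show ((2 * p : ℚ) : F) = (p + q * s) + (p - q * s) by push_cast; ring]
    exact ht.add ht')
  obtain ⟨n, hn⟩ := exists_int (p ^ 2 - d * q ^ 2) (by
    rw [show ((p ^ 2 - d * q ^ 2 : ℚ) : F) = (p + q * s) * (p - q * s) by
      push_cast; linear_combination (q : F) ^ 2 * h.sq_eq]
    exact ht.mul ht')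
  have hs2 : (σ₀ s) ^ 2 = d := by rw [← map_pow, h.sq_eq, map_natCast]
  have e0 : σ₀ ((p : F) + q * s) = p + q * σ₀ s := by simp
  have e1 : σ₁ ((p : F) + q * s) = p - q * σ₀ s := by simp [hσ]; ring
  rw [e0, abs_le] at h0
  rw [e1, abs_le] at h1
  have haR : 2 * (p : ℝ) = a := by exact_mod_cast congrArg (Rat.cast : ℚ → ℝ) ha
  have hnR : (p : ℝ) ^ 2 - d * q ^ 2 = n := by exact_mod_cast congrArg (Rat.cast : ℚ → ℝ) hn
  have b1 : 0 ≤ 4 - 2 * a + n := by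
    have : (0 : ℝ) ≤ 4 - 2 * a + n := by
      rw [← haR, ← hnR, ← hs2]; nlinarith
    exact_mod_cast this
  have b2 : 0 ≤ 4 + 2 * a + n := by
    have : (0 : ℝ) ≤ 4 + 2 * a + n := by
      rw [← haR, ← hnR, ← hs2]; nlinarith
    exact_mod_cast this
  have b3 : -4 ≤ a ∧ a ≤ 4 := by
    have : (-4 : ℝ) ≤ a ∧ (a : ℝ) ≤ 4 := by
      rw [← haR]; constructor <;> linarith
    exact_mod_cast this
  have hd0 : (d : ℚ) ≠ 0 := by
    have := h.six_le
    exact_mod_cast (by omega : d ≠ 0)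
  -- `2 * q` is an integer because `d * (2 * q) ^ 2` is an integer and `d` is squarefree
  have hD : (d : ℚ) * (2 * q) ^ 2 = ((a ^ 2 - 4 * n : ℤ) : ℚ) := by
    push_cast; rw [← ha, ← hn]; ring
  obtain ⟨c, hc⟩ : ∃ c : ℤ, 2 * q = c := by
    have h5 : IsSquare (((d : ℤ) * (a ^ 2 - 4 * n) : ℤ) : ℚ) :=
      ⟨d * (2 * q), by push_cast at hD ⊢; rw [← hD]; ring⟩
    rw [Rat.isSquare_intCast_iff] at h5
    obtain ⟨m, hm⟩ := h5
    have h7 : (d : ℤ) ∣ m := ((Int.squarefree_natCast.2 h.squarefree).dvd_pow_iff_dvd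
      two_ne_zero).1 ⟨_, by rw [sq, hm]⟩
    obtain ⟨c, rfl⟩ := h7
    have h8 : (2 * q) ^ 2 = (c : ℚ) ^ 2 := by
      have hm' : (d : ℚ) * (a ^ 2 - 4 * n) = d * c * (d * c) := by exact_mod_cast hm
      push_cast at hD
      apply mul_left_cancel₀ hd0
      apply mul_left_cancel₀ hd0
      rw [hD, hm']; ring
    rcases sq_eq_sq_iff_eq_or_eq_neg.1 h8 with h9 | h9
    · exact ⟨c, h9⟩
    · exact ⟨-c, by rw [h9]; push_cast; rfl⟩
  have hDz : (d : ℤ) * c ^ 2 = a ^ 2 - 4 * n := by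
    rw [hc] at hD; exact_mod_cast hD
  have hc0 : c = 0 := by
    by_contra hc0
    have hc1 : 1 ≤ c ^ 2 := sq_pos_of_ne_zero hc0
    have hd6 : (6 : ℤ) ≤ d := by exact_mod_cast h.six_le
    have hb : a ^ 2 - 4 * n ≤ 16 := by
      obtain ⟨h3, h4⟩ := b3
      interval_cases a <;> omega
    have hc2 : c ^ 2 ≤ 2 := by nlinarith
    have hc3 : c ^ 2 = 1 := by
      have : c ≤ 1 := by nlinarith
      have : -1 ≤ c := by nlinarith
      interval_cases c <;> simp_all
    rw [hc3, mul_one] at hDz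
    have hsf : ∀ m : ℕ, d ≠ 4 * m := by
      rintro m rfl
      have := h.squarefree 2 ⟨m, by ring⟩
      simp at this
    have hsf9 : d ≠ 9 := by
      rintro rfl
      have := h.squarefree 3 ⟨1, by ring⟩
      simp at this
    have hsf1 := hsf (d / 4)
    obtain ⟨h3, h4⟩ := b3
    interval_cases a <;> omega
  have hq : q = 0 := by
    rw [hc0] at hc; simpa using hc
  subst hq
  obtain ⟨m, hm⟩ := exists_int p (by simpa using ht)
  refine ⟨m, by simp [hm], ?_, ?_⟩
  · have : (-2 : ℝ) ≤ m := by have := h0.1; simp [hm] at this; exact this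
    exact_mod_cast this
  · have : (m : ℝ) ≤ 2 := by have := h0.2; simp [hm] at this; exact this
    exact_mod_cast this

end RealQuadratic

section FundamentalUnit

variable {F : Type} [Field F]

lemma coe_unit_zpow (u : (𝓞 F)ˣ) (k : ℤ) :
    algebraMap (𝓞 F) F ((u ^ k : (𝓞 F)ˣ) : 𝓞 F) = (algebraMap (𝓞 F) F u) ^ k := by
  have := congrArg Units.val (map_zpow (Units.map (algebraMap (𝓞 F) F).toMonoidHom) u k)
  rwa [Units.val_zpow_eq_zpow_val] at this

lemma unit_eq_of_real_eq (σ : F →+* ℝ) {u v : (𝓞 F)ˣ}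
    (h : σ (algebraMap (𝓞 F) F u) = σ (algebraMap (𝓞 F) F v)) : u = v :=
  Units.ext (FaithfulSMul.algebraMap_injective (𝓞 F) F (σ.injective h))

/-- `ε` is the least unit that is greater than `1` at `σ`. -/
structure IsFundamentalUnit (σ : F →+* ℝ) (ε : (𝓞 F)ˣ) : Prop where
  one_lt : 1 < σ (algebraMap (𝓞 F) F ↑ε)
  le : ∀ u : (𝓞 F)ˣ, 1 < σ (algebraMap (𝓞 F) F ↑u) →
      σ (algebraMap (𝓞 F) F ↑ε) ≤ σ (algebraMap (𝓞 F) F ↑u)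

variable {σ : F →+* ℝ} {ε : (𝓞 F)ˣ}

lemma IsFundamentalUnit.eq_zpow (h : IsFundamentalUnit σ ε) {u : (𝓞 F)ˣ}
    (hu : 0 < σ (algebraMap (𝓞 F) F u)) : ∃ k : ℤ, u = ε ^ k := by
  obtain ⟨k, hk1, hk2⟩ := exists_mem_Ico_zpow hu h.one_lt
  refine ⟨k, ?_⟩
  have hpos : 0 < σ (algebraMap (𝓞 F) F ε) := by linarith [h.one_lt]
  have hv : σ (algebraMap (𝓞 F) F ((u * ε ^ (-k) : (𝓞 F)ˣ) : 𝓞 F)) =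
      σ (algebraMap (𝓞 F) F u) / σ (algebraMap (𝓞 F) F ε) ^ k := by
    rw [Units.val_mul, map_mul, coe_unit_zpow, map_mul, map_zpow₀, zpow_neg, div_eq_mul_inv]
  have h1 : ¬ 1 < σ (algebraMap (𝓞 F) F ((u * ε ^ (-k) : (𝓞 F)ˣ) : 𝓞 F)) := by
    intro hlt
    have := h.le _ hlt
    rw [hv, le_div_iff₀ (zpow_pos hpos k)] at this
    rw [zpow_add_one₀ hpos.ne'] at hk2
    linarith
  apply unit_eq_of_real_eq σ
  rw [coe_unit_zpow, map_zpow₀]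
  rw [hv, not_lt, div_le_one (zpow_pos hpos k)] at h1
  exact le_antisymm h1 hk1

lemma IsFundamentalUnit.eq_sq_or (h : IsFundamentalUnit σ ε) {u : (𝓞 F)ˣ}
    (hu : 0 < σ (algebraMap (𝓞 F) F u)) : ∃ r : (𝓞 F)ˣ, u = r ^ 2 ∨ u = ε * r ^ 2 := by
  obtain ⟨k, rfl⟩ := h.eq_zpow hu
  obtain ⟨m, rfl | rfl⟩ := Int.even_or_odd' k
  · exact ⟨ε ^ m, Or.inl (by rw [← zpow_natCast, ← zpow_mul]; congr 1; push_cast; ring)⟩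
  · refine ⟨ε ^ m, Or.inr ?_⟩
    rw [← zpow_natCast, ← zpow_mul, ← zpow_one_add]; congr 1; push_cast; ring

lemma IsFundamentalUnit.ne_sq (h : IsFundamentalUnit σ ε) (r : (𝓞 F)ˣ) : ε ≠ r ^ 2 := by
  have key : ∀ r : (𝓞 F)ˣ, 0 < σ (algebraMap (𝓞 F) F r) → ε ≠ r ^ 2 := by
    intro r hr he
    have h1 : σ (algebraMap (𝓞 F) F ε) = σ (algebraMap (𝓞 F) F r) ^ 2 := by
      rw [he]; simp
    have h2 := h.one_lt
    rw [h1] at h2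
    have h3 : 1 < σ (algebraMap (𝓞 F) F r) := by nlinarith
    have h4 := h.le r h3
    rw [h1] at h4
    nlinarith
  rcases lt_trichotomy (σ (algebraMap (𝓞 F) F r)) 0 with h0 | h0 | h0
  · rw [← neg_sq]
    exact key (-r) (by simpa using h0)
  · simp at h0
  · exact key r h0

lemma exists_unit_of_isIntegral {x y : F} (hx : IsIntegral ℤ x) (hy : IsIntegral ℤ y)
    (hxy : x * y = 1) : ∃ u : (𝓞 F)ˣ, algebraMap (𝓞 F) F u = x := by
  refine ⟨⟨⟨x, hx⟩, ⟨y, hy⟩, ?_, ?_⟩, rfl⟩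
  · exact RingOfIntegers.ext hxy
  · exact RingOfIntegers.ext ((mul_comm y x).trans hxy)

end FundamentalUnit

section ReducedNorm

variable {F : Type} [Field F] {A B : F}

lemma redNorm_eq (x : ℍ[F, A, B]) :
    redNorm F x = x.re ^ 2 - A * x.imI ^ 2 - B * x.imJ ^ 2 + A * B * x.imK ^ 2 := by
  simp [redNorm]; ring

lemma redNorm_mul (x y : ℍ[F, A, B]) : redNorm F (x * y) = redNorm F x * redNorm F y := by
  simp only [redNorm_eq, QuaternionAlgebra.re_mul, QuaternionAlgebra.imI_mul,
    QuaternionAlgebra.imJ_mul, QuaternionAlgebra.imK_mul]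
  ring

lemma redNorm_algebraMap (r : F) : redNorm F (algebraMap F ℍ[F, A, B] r) = r ^ 2 := by
  simp [redNorm_eq, QuaternionAlgebra.algebraMap_eq]

lemma redNorm_one : redNorm F (1 : ℍ[F, A, B]) = 1 := by
  simp [redNorm_eq]

lemma mul_star_eq (x : ℍ[F, A, B]) : x * star x = algebraMap F _ (redNorm F x) := by
  ext <;> simp [redNorm_eq, QuaternionAlgebra.algebraMap_eq] <;> ring

lemma star_mul_eq (x : ℍ[F, A, B]) : star x * x = algebraMap F _ (redNorm F x) := by
  ext <;> simp [redNorm_eq, QuaternionAlgebra.algebraMap_eq] <;> ring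

lemma star_eq (x : ℍ[F, A, B]) : star x = algebraMap F _ (2 * x.re) - x := by
  ext <;> simp [QuaternionAlgebra.algebraMap_eq]; ring

lemma redNorm_star (x : ℍ[F, A, B]) : redNorm F (star x) = redNorm F x := by
  simp [redNorm_eq]

lemma mul_self_eq (x : ℍ[F, A, B]) :
    x * x = algebraMap F _ (2 * x.re) * x - algebraMap F _ (redNorm F x) := by
  rw [← star_mul_eq, star_eq, sub_mul]; abel

lemma re_algebraMap_mul (r : F) (x : ℍ[F, A, B]) : (algebraMap F _ r * x).re = r * x.re := by
  simp [QuaternionAlgebra.algebraMap_eq]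

section Definite

variable {σ : F →+* ℝ}

lemma sq_re_le_redNorm (hA : σ A < 0) (hB : σ B < 0) (x : ℍ[F, A, B]) :
    σ x.re ^ 2 ≤ σ (redNorm F x) := by
  rw [redNorm_eq]
  simp only [map_add, map_sub, map_mul, map_pow]
  nlinarith [mul_nonneg (neg_pos.2 hA).le (sq_nonneg (σ x.imI)),
    mul_nonneg (neg_pos.2 hB).le (sq_nonneg (σ x.imJ)),
    mul_nonneg (mul_pos_of_neg_of_neg hA hB).le (sq_nonneg (σ x.imK))]

lemma eq_zero_of_redNorm_eq_zero (hA : σ A < 0) (hB : σ B < 0) {x : ℍ[F, A, B]}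
    (hx : redNorm F x = 0) : x = 0 := by
  have h := congrArg σ hx
  rw [redNorm_eq] at h
  simp only [map_add, map_sub, map_mul, map_pow, map_zero] at h
  have h1 := mul_nonneg (neg_pos.2 hA).le (sq_nonneg (σ x.imI))
  have h2 := mul_nonneg (neg_pos.2 hB).le (sq_nonneg (σ x.imJ))
  have h3 := mul_nonneg (mul_pos_of_neg_of_neg hA hB).le (sq_nonneg (σ x.imK))
  have h4 := sq_nonneg (σ x.re)
  have z1 : -σ A * σ x.imI ^ 2 = 0 := by linarith
  have z2 : -σ B * σ x.imJ ^ 2 = 0 := by linarith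
  have z3 : σ A * σ B * σ x.imK ^ 2 = 0 := by linarith
  have z4 : σ x.re ^ 2 = 0 := by linarith
  ext
  · simpa using z4
  · simpa [(ne_of_lt hA)] using z1
  · simpa [(ne_of_lt hB)] using z2
  · simpa [(ne_of_lt hA), (ne_of_lt hB)] using z3

lemma redNorm_pos (hA : σ A < 0) (hB : σ B < 0) {x : ℍ[F, A, B]} (hx : x ≠ 0) :
    0 < σ (redNorm F x) := by
  have h1 := sq_re_le_redNorm hA hB x
  have h2 : σ (redNorm F x) ≠ 0 := by
    intro h
    exact hx (eq_zero_of_redNorm_eq_zero hA hB (σ.injective (by simpa using h)))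
  exact lt_of_le_of_ne ((sq_nonneg _).trans h1) h2.symm

end Definite
end ReducedNorm

section Orders

variable {F : Type} [Field F] {A B : F}

lemma isIntegral_trace {x : ℍ[F, A, B]} (hx : IsIntegral ℤ x) : IsIntegral ℤ (2 * x.re) := by
  by_cases hsc : ∃ r : F, x = algebraMap F _ r
  · obtain ⟨r, rfl⟩ := hsc
    have hr : IsIntegral ℤ r :=
      (isIntegral_algHom_iff ((algebraMap F ℍ[F, A, B]).toIntAlgHom)
        (algebraMap F ℍ[F, A, B]).injective).1 hx
    have : (algebraMap F ℍ[F, A, B] r).re = r := by simp [QuaternionAlgebra.algebraMap_eq]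
    rw [this, two_mul]
    exact hr.add hr
  · obtain ⟨p, hp, hpx⟩ := hx
    let g : Polynomial F :=
      Polynomial.X ^ 2 + Polynomial.C (-(2 * x.re)) * Polynomial.X + Polynomial.C (redNorm F x)
    have hgm : g.Monic := by unfold g; monicity!
    have hgx : Polynomial.aeval x g = 0 := by
      simp only [g, map_add, map_mul, Polynomial.aeval_X, Polynomial.aeval_C, map_neg, sq,
        mul_self_eq x]
      rw [← map_mul]
      noncomm_ring
    have hdvd : g ∣ p.map (algebraMap ℤ F) := by
      rw [← Polynomial.modByMonic_eq_zero_iff_dvd hgm]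
      set r := p.map (algebraMap ℤ F) %ₘ g with hr
      have hrx : Polynomial.aeval x r = 0 := by
        have h1 := congrArg (Polynomial.aeval x)
          (Polynomial.modByMonic_add_div (p.map (algebraMap ℤ F)) g)
        rw [map_add, map_mul, hgx, zero_mul, add_zero, Polynomial.aeval_map_algebraMap] at h1
        rw [hr, h1]; exact hpx
      have hg2 : g.natDegree = 2 := by unfold g; compute_degree!
      have hdeg : r.natDegree ≤ 1 := by
        have := Polynomial.natDegree_modByMonic_lt (p.map (algebraMap ℤ F)) hgm
          (by intro h; rw [h] at hg2; simp at hg2)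
        rw [← hr] at this
        omega
      rw [Polynomial.eq_X_add_C_of_natDegree_le_one hdeg] at hrx ⊢
      simp only [map_add, map_mul, Polynomial.aeval_X, Polynomial.aeval_C] at hrx
      have ha : r.coeff 1 = 0 := by
        by_contra ha
        refine hsc ⟨-(r.coeff 0) / r.coeff 1, ?_⟩
        have h2 : algebraMap F ℍ[F, A, B] (r.coeff 1)⁻¹ * (algebraMap F _ (r.coeff 1) * x +
          algebraMap F _ (r.coeff 0)) = 0 := by rw [hrx, mul_zero]
        rw [mul_add, ← mul_assoc, ← map_mul, ← map_mul, inv_mul_cancel₀ ha, map_one, one_mul] at h2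
        rw [eq_neg_of_add_eq_zero_left h2, ← map_neg]
        congr 1; field_simp
      rw [ha, map_zero, zero_mul, zero_add] at hrx
      have hb : r.coeff 0 = 0 := (map_eq_zero_iff _ (algebraMap F ℍ[F, A, B]).injective).1 hrx
      simp [ha, hb]
    have hl := integralClosure.mem_lifts_of_monic_of_dvd_map F hp hgm hdvd
    rw [Polynomial.lifts_iff_coeff_lifts] at hl
    obtain ⟨c, hc⟩ := hl 1
    have hg1 : g.coeff 1 = -(2 * x.re) := by
      simp [g]
    rw [hg1] at hc
    rw [← IsIntegral.neg_iff, ← hc]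
    exact c.2

variable {O : Subring ℍ[F, A, B]}

lemma IsOrder.isIntegral {H : Type} [Ring H] [Algebra F H] {O : Subring H} (hO : IsOrder F O)
    {x : H} (hx : x ∈ O) : IsIntegral ℤ x :=
  IsIntegral.of_mem_of_fg (subalgebraOfSubring O)
    ((Submodule.fg_iff_addSubgroup_fg _).2 hO.2.1) x hx

lemma IsOrder.algebraMap_mem {H : Type} [Ring H] [Algebra F H] {O : Subring H}
    (hO : IsOrder F O) {r : F} (hr : IsIntegral ℤ r) : algebraMap F H r ∈ O :=
  hO.1 ⟨⟨r, hr⟩, rfl⟩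

lemma IsOrder.unit_mem {H : Type} [Ring H] [Algebra F H] {O : Subring H} (hO : IsOrder F O)
    (r : (𝓞 F)ˣ) : algebraMap F H (algebraMap (𝓞 F) F r) ∈ O :=
  hO.1 ⟨r, rfl⟩

lemma IsOrder.unit_inv_mem {H : Type} [Ring H] [Algebra F H] {O : Subring H} (hO : IsOrder F O)
    (r : (𝓞 F)ˣ) : algebraMap F H (algebraMap (𝓞 F) F r)⁻¹ ∈ O := by
  have := hO.unit_mem r⁻¹
  rwa [map_units_inv] at this

lemma IsOrder.trace_integral (hO : IsOrder F O) {x : ℍ[F, A, B]} (hx : x ∈ O) :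
    IsIntegral ℤ (2 * x.re) :=
  isIntegral_trace (hO.isIntegral hx)

lemma IsOrder.star_mem (hO : IsOrder F O) {x : ℍ[F, A, B]} (hx : x ∈ O) : star x ∈ O := by
  rw [star_eq]
  exact sub_mem (hO.algebraMap_mem (hO.trace_integral hx)) hx

lemma IsOrder.integral_of_algebraMap_mem {H : Type} [Ring H] [Nontrivial H] [Algebra F H]
    {O : Subring H} (hO : IsOrder F O) {r : F} (hr : algebraMap F H r ∈ O) : IsIntegral ℤ r :=
  (isIntegral_algHom_iff ((algebraMap F H).toIntAlgHom) (algebraMap F H).injective).1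
    (hO.isIntegral hr)

lemma IsOrder.redNorm_integral (hO : IsOrder F O) {x : ℍ[F, A, B]} (hx : x ∈ O) :
    IsIntegral ℤ (redNorm F x) := by
  apply hO.integral_of_algebraMap_mem
  rw [← mul_star_eq]
  exact mul_mem hx (hO.star_mem hx)

lemma IsOrder.exists_redNorm_eq (hO : IsOrder F O) (u : (↥O)ˣ) :
    ∃ n : (𝓞 F)ˣ, redNorm F ((u : ↥O) : ℍ[F, A, B]) = algebraMap (𝓞 F) F n := by
  obtain ⟨n, hn⟩ := exists_unit_of_isIntegral (hO.redNorm_integral (u : ↥O).2)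
    (hO.redNorm_integral ((u⁻¹ : (↥O)ˣ) : ↥O).2) (by
      rw [← redNorm_mul, ← Subring.coe_mul, Units.mul_inv, Subring.coe_one, redNorm_one])
  exact ⟨n, hn.symm⟩

lemma IsOrder.exists_unit (hO : IsOrder F O) {x : ℍ[F, A, B]} (hx : x ∈ O) {n : (𝓞 F)ˣ}
    (hn : redNorm F x = algebraMap (𝓞 F) F n) : ∃ u : (↥O)ˣ, ((u : ↥O) : ℍ[F, A, B]) = x := by
  have hn0 : algebraMap (𝓞 F) F n ≠ 0 := by simp
  refine ⟨⟨⟨x, hx⟩, ⟨algebraMap F _ (algebraMap (𝓞 F) F n)⁻¹ * star x,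
    mul_mem (hO.unit_inv_mem n) (hO.star_mem hx)⟩, ?_, ?_⟩, rfl⟩
  · ext1
    change x * (_ * star x) = 1
    rw [← mul_assoc, ← Algebra.commutes, mul_assoc, mul_star_eq, hn, ← map_mul,
      inv_mul_cancel₀ hn0, map_one]
  · ext1
    change (_ * star x) * x = 1
    rw [mul_assoc, star_mul_eq, hn, ← map_mul, inv_mul_cancel₀ hn0, map_one]

lemma IsOrder.exists_unit_of_redNorm_eq_one (hO : IsOrder F O) {x : ℍ[F, A, B]} (hx : x ∈ O)
    (hn : redNorm F x = 1) : ∃ u : (↥O)ˣ, ((u : ↥O) : ℍ[F, A, B]) = x :=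
  hO.exists_unit (n := 1) hx (by simpa using hn)

/-- An element of the order that is a scalar as well as a unit comes from `O_F^×`. -/
lemma IsOrder.isScalarUnit_iff (hO : IsOrder F O) (u : (↥O)ˣ) :
    IsScalarUnit F u ↔ ∃ r : F, ((u : ↥O) : ℍ[F, A, B]) = algebraMap F _ r := by
  constructor
  · rintro ⟨r, hr⟩; exact ⟨_, hr⟩
  · rintro ⟨r, hr⟩
    have hr1 : IsIntegral ℤ r := by
      apply hO.integral_of_algebraMap_mem (H := ℍ[F, A, B])
      rw [← hr]; exact (u : ↥O).2
    have hinv : (((u⁻¹ : (↥O)ˣ) : ↥O) : ℍ[F, A, B]) = algebraMap F _ r⁻¹ := by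
      have hmul : ((u : ↥O) : ℍ[F, A, B]) * ((u⁻¹ : (↥O)ˣ) : ↥O) = 1 := by
        rw [← Subring.coe_mul, Units.mul_inv, Subring.coe_one]
      have hr0 : r ≠ 0 := by
        rintro rfl
        rw [hr] at hmul
        simp at hmul
      rw [hr] at hmul
      have h2 := congrArg (algebraMap F ℍ[F, A, B] r⁻¹ * ·) hmul
      simpa only [← mul_assoc, ← map_mul, inv_mul_cancel₀ hr0, map_one, one_mul, mul_one] using h2
    have hr2 : IsIntegral ℤ r⁻¹ := by
      apply hO.integral_of_algebraMap_mem (H := ℍ[F, A, B])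
      rw [← hinv]; exact ((u⁻¹ : (↥O)ˣ) : ↥O).2
    have hr0 : r ≠ 0 := by
      rintro rfl
      have hmul : ((u : ↥O) : ℍ[F, A, B]) * ((u⁻¹ : (↥O)ˣ) : ↥O) = 1 := by
        rw [← Subring.coe_mul, Units.mul_inv, Subring.coe_one]
      rw [hr] at hmul
      simp at hmul
    obtain ⟨n, hn⟩ := exists_unit_of_isIntegral hr1 hr2 (mul_inv_cancel₀ hr0)
    exact ⟨n, by rw [hn, hr]⟩

end Orders

section Extraction

/-- The arithmetic input on a real quadratic field: `ε` generates the units that are positive at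
`σ₀` up to squares, small integers are rational, and neither `2` nor `3` is a square. -/
structure SmallUnitData {F : Type} [Field F] (σ₀ σ₁ : F →+* ℝ) (ε : (𝓞 F)ˣ) : Prop where
  pos : 0 < σ₀ (algebraMap (𝓞 F) F ε)
  eq_sq_or : ∀ u : (𝓞 F)ˣ, 0 < σ₀ (algebraMap (𝓞 F) F u) →
    ∃ r : (𝓞 F)ˣ, u = r ^ 2 ∨ u = ε * r ^ 2
  ne_sq : ∀ r : (𝓞 F)ˣ, ε ≠ r ^ 2
  sq_ne_two : ∀ x : F, x ^ 2 ≠ 2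
  sq_ne_three : ∀ x : F, x ^ 2 ≠ 3
  exists_int_eq : ∀ t : F, IsIntegral ℤ t → |σ₀ t| ≤ 2 → |σ₁ t| ≤ 2 →
    ∃ n : ℤ, t = n ∧ -2 ≤ n ∧ n ≤ 2

lemma SmallUnitData.ne_zero {F : Type} [Field F] {σ₀ σ₁ : F →+* ℝ} {ε : (𝓞 F)ˣ}
    (_ : SmallUnitData σ₀ σ₁ ε) : algebraMap (𝓞 F) F ε ≠ 0 := by
  simp

/-- Elements `v`, `w` satisfying the relations of `i` and `(1 + j) / 2` in `(-e, -3)`. -/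
structure IsPair {H : Type} [Ring H] (e v w : H) : Prop where
  mul_self : v * v = -e
  sq : w * w = w - 1
  mul_comm : v * w = (1 - w) * v

variable {F : Type} [Field F] {A B : F}

/-- The quaternion `x` lies in the base field. -/
def IsScalar (x : ℍ[F, A, B]) : Prop := ∃ r : F, x = algebraMap F _ r

lemma IsScalar.eq_zero_of_mul_eq {x : ℍ[F, A, B]} (hx : ¬IsScalar x) {a b : F}
    (h : algebraMap F _ a * x = algebraMap F _ b) : a = 0 := by
  by_contra ha
  refine hx ⟨a⁻¹ * b, ?_⟩
  rw [map_mul, ← h, ← mul_assoc, ← map_mul, inv_mul_cancel₀ ha, map_one, one_mul]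

lemma isScalar_algebraMap_mul {x : ℍ[F, A, B]} {a : F} (ha : a ≠ 0) :
    IsScalar (algebraMap F _ a * x) ↔ IsScalar x := by
  constructor
  · rintro ⟨r, hr⟩
    by_contra hx
    exact ha (IsScalar.eq_zero_of_mul_eq hx hr)
  · rintro ⟨r, rfl⟩
    exact ⟨a * r, by rw [map_mul]⟩

lemma re_eq_zero_of_mul_self [CharZero F] {x : ℍ[F, A, B]} (hx : ¬IsScalar x)
    (h : IsScalar (x * x)) : x.re = 0 := by
  obtain ⟨r, hr⟩ := h
  rw [mul_self_eq, sub_eq_iff_eq_add, ← map_add] at hr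
  simpa using IsScalar.eq_zero_of_mul_eq hx hr

lemma mul_self_of_re_eq_zero {x : ℍ[F, A, B]} (h : x.re = 0) :
    x * x = -algebraMap F _ (redNorm F x) := by
  rw [mul_self_eq, h]; simp

lemma mul_mul_eq (x : ℍ[F, A, B]) :
    x * x * x = algebraMap F _ ((2 * x.re) ^ 2 - redNorm F x) * x
      - algebraMap F _ (2 * x.re * redNorm F x) := by
  rw [mul_self_eq, sub_mul, mul_assoc, mul_self_eq, mul_sub, ← mul_assoc, ← map_mul, ← map_mul,
    sq, map_sub, sub_mul]
  abel

/-- The square of the trace of a nonscalar element with scalar cube is its reduced norm. -/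
lemma sq_trace_of_cube {x : ℍ[F, A, B]} (hx : ¬IsScalar x) (h : IsScalar (x * x * x)) :
    (2 * x.re) ^ 2 = redNorm F x := by
  obtain ⟨r, hr⟩ := h
  rw [mul_mul_eq, sub_eq_iff_eq_add, ← map_add] at hr
  exact sub_eq_zero.1 (IsScalar.eq_zero_of_mul_eq hx hr)

lemma sq_trace_of_fourth_power [CharZero F] {x : ℍ[F, A, B]} (hx : ¬IsScalar (x * x))
    (h : IsScalar (x * x * (x * x))) : (2 * x.re) ^ 2 = 2 * redNorm F x := by
  have h1 := re_eq_zero_of_mul_self hx h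
  rw [mul_self_eq, QuaternionAlgebra.re_sub, re_algebraMap_mul] at h1
  have h2 : (algebraMap F ℍ[F, A, B] (redNorm F x)).re = redNorm F x := by
    simp [QuaternionAlgebra.algebraMap_eq]
  rw [h2] at h1
  linear_combination 2 * h1

lemma sq_trace_of_sixth_power [CharZero F] {x : ℍ[F, A, B]} (hx2 : ¬IsScalar (x * x))
    (hx : ¬IsScalar (x * x * x)) (h : IsScalar (x * x * x * (x * x * x))) :
    (2 * x.re) ^ 2 = 3 * redNorm F x := by
  have h1 := re_eq_zero_of_mul_self hx h
  rw [mul_mul_eq, QuaternionAlgebra.re_sub, re_algebraMap_mul] at h1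
  have h2 (r : F) : (algebraMap F ℍ[F, A, B] r).re = r := by
    simp [QuaternionAlgebra.algebraMap_eq]
  rw [h2] at h1
  have h3 : x.re * ((2 * x.re) ^ 2 - 3 * redNorm F x) = 0 := by linear_combination h1
  rcases mul_eq_zero.1 h3 with h0 | h0
  · exact absurd ⟨-redNorm F x, by rw [mul_self_of_re_eq_zero h0, map_neg]⟩ hx2
  · linear_combination h0

variable {O : Subring ℍ[F, A, B]}

lemma redNorm_unit_ne_zero (u : (↥O)ˣ) : redNorm F ((u : ↥O) : ℍ[F, A, B]) ≠ 0 := by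
  intro h
  have h1 : redNorm F (((u : ↥O) : ℍ[F, A, B]) * (((u⁻¹ : (↥O)ˣ) : ↥O) : ℍ[F, A, B])) = 1 := by
    rw [← Subring.coe_mul, Units.mul_inv, Subring.coe_one, redNorm_one]
  rw [redNorm_mul, h, zero_mul] at h1
  exact zero_ne_one h1

lemma coe_unit_ne_zero (u : (↥O)ˣ) : ((u : ↥O) : ℍ[F, A, B]) ≠ 0 := by
  intro h
  apply redNorm_unit_ne_zero u
  rw [h]; simp [redNorm_eq]

/-- A nonscalar unit whose cube is scalar has a square reduced norm. -/
lemma IsOrder.exists_redNorm_sq (hO : IsOrder F O) (c : (↥O)ˣ)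
    (hc : ¬IsScalar ((c : ↥O) : ℍ[F, A, B]))
    (hc3 : IsScalar (((c * c * c : (↥O)ˣ) : ↥O) : ℍ[F, A, B])) :
    ∃ t : (𝓞 F)ˣ, algebraMap (𝓞 F) F t = 2 * ((c : ↥O) : ℍ[F, A, B]).re ∧
      redNorm F ((c : ↥O) : ℍ[F, A, B]) = algebraMap (𝓞 F) F t ^ 2 := by
  have h := sq_trace_of_cube hc hc3
  obtain ⟨n, hn⟩ := hO.exists_redNorm_eq c
  have ht := hO.trace_integral (c : ↥O).2
  have hn0 : algebraMap (𝓞 F) F n ≠ 0 := by simp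
  obtain ⟨t, h1⟩ := exists_unit_of_isIntegral ht
    (ht.mul (n⁻¹ : (𝓞 F)ˣ).1.2) (by
      change _ * (_ * algebraMap (𝓞 F) F (n⁻¹ : (𝓞 F)ˣ)) = 1
      rw [map_units_inv, ← mul_assoc, ← sq, h, hn, mul_inv_cancel₀ hn0])
  exact ⟨t, h1, by rw [h1, h]⟩

variable {σ₀ σ₁ : F →+* ℝ} {ε : (𝓞 F)ˣ}

/-- An involution with nonsquare reduced norm inverting an element of order three in the reduced
unit group yields a copy of the relations of `(-ε, -3)` inside the order. -/
theorem IsOrder.exists_isPair [CharZero F] (hO : IsOrder F O) (D : SmallUnitData σ₀ σ₁ ε)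
    (hA₀ : σ₀ A < 0) (hB₀ : σ₀ B < 0) (hA₁ : σ₁ A < 0) (hB₁ : σ₁ B < 0) (u c : (↥O)ˣ)
    (hu : ¬IsScalar ((u : ↥O) : ℍ[F, A, B])) (hu2 : IsScalar (((u * u : (↥O)ˣ) : ↥O) : ℍ[F, A, B]))
    (hc : ¬IsScalar ((c : ↥O) : ℍ[F, A, B]))
    (hc3 : IsScalar (((c * c * c : (↥O)ˣ) : ↥O) : ℍ[F, A, B]))
    (hucu : IsScalar (((u * c * u * c : (↥O)ˣ) : ↥O) : ℍ[F, A, B]))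
    (hns : ∀ r : (𝓞 F)ˣ, redNorm F ((u : ↥O) : ℍ[F, A, B]) ≠ algebraMap (𝓞 F) F r ^ 2) :
    0 < σ₁ (algebraMap (𝓞 F) F ε) ∧ ∃ v w : ℍ[F, A, B], v ∈ O ∧ w ∈ O ∧
      IsPair (algebraMap F _ (algebraMap (𝓞 F) F ε)) v w := by
  obtain ⟨n, hn⟩ := hO.exists_redNorm_eq u
  have hn₀ : 0 < σ₀ (algebraMap (𝓞 F) F n) := hn ▸ redNorm_pos hA₀ hB₀ (coe_unit_ne_zero u)
  have hn₁ : 0 < σ₁ (algebraMap (𝓞 F) F n) := hn ▸ redNorm_pos hA₁ hB₁ (coe_unit_ne_zero u)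
  obtain ⟨r, hr | hr⟩ := D.eq_sq_or n hn₀
  · exact absurd (by rw [hn, hr]; simp) (hns r)
  set e := algebraMap (𝓞 F) F ε with he
  set ρ := algebraMap (𝓞 F) F r with hρ
  have hρ0 : ρ ≠ 0 := by simp [hρ]
  have hne : redNorm F ((u : ↥O) : ℍ[F, A, B]) = e * ρ ^ 2 := by rw [hn, hr]; simp [he, hρ]
  have hpos : 0 < σ₁ e := by
    rw [← hn, hne, map_mul, map_pow] at hn₁
    exact pos_of_mul_pos_left hn₁ (sq_nonneg _)
  obtain ⟨t, ht, htn⟩ := hO.exists_redNorm_sq c hc hc3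
  set θ := algebraMap (𝓞 F) F t with hθ
  have hθ0 : θ ≠ 0 := by simp [hθ]
  set U := ((u : ↥O) : ℍ[F, A, B]) with hU
  set C := ((c : ↥O) : ℍ[F, A, B]) with hC
  set v := algebraMap F ℍ[F, A, B] ρ⁻¹ * U with hv
  set w := algebraMap F ℍ[F, A, B] θ⁻¹ * C with hw
  have hv0 : v.re = 0 := by
    rw [hv, re_algebraMap_mul, re_eq_zero_of_mul_self hu hu2, mul_zero]
  have hvN : redNorm F v = e := by
    rw [hv, redNorm_mul, redNorm_algebraMap, hne]; field_simp
  have hvv : v * v = -algebraMap F _ e := by rw [mul_self_of_re_eq_zero hv0, hvN]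
  have hwN : redNorm F w = 1 := by
    rw [hw, redNorm_mul, redNorm_algebraMap, htn]; field_simp
  have hwt : 2 * w.re = 1 := by
    rw [hw, re_algebraMap_mul]
    have : θ⁻¹ * θ = 1 := inv_mul_cancel₀ hθ0
    linear_combination this - θ⁻¹ * ht
  have hww : w * w = w - 1 := by rw [mul_self_eq, hwt, hwN]; simp
  have hwns : ¬IsScalar w := by rwa [hw, isScalar_algebraMap_mul (inv_ne_zero hθ0)]
  have hyns : ¬IsScalar (v * w) := by
    rintro ⟨q, hq⟩
    have h1 : algebraMap F _ (-e) * w = algebraMap F _ q * v := by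
      rw [map_neg, ← hvv, mul_assoc, hq, Algebra.commutes]
    have h2 : w = algebraMap F _ ((-e)⁻¹ * q) * v := by
      rw [map_mul, mul_assoc, ← h1, ← mul_assoc, ← map_mul,
        inv_mul_cancel₀ (neg_ne_zero.2 D.ne_zero), map_one, one_mul]
    refine hwns ⟨((-e)⁻¹ * q) ^ 2 * (-e) + 1, ?_⟩
    rw [map_add, map_one, map_mul, sq, map_mul, map_neg, ← hvv, ← sub_eq_iff_eq_add, ← hww]
    conv_lhs => rw [h2]
    rw [mul_assoc, ← mul_assoc v, ← Algebra.commutes _ v]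
    simp only [mul_assoc]
  have hysc : IsScalar (v * w * (v * w)) := by
    obtain ⟨q, hq⟩ := hucu
    have hq' : U * C * U * C = algebraMap F _ q := hq
    refine ⟨ρ⁻¹ * θ⁻¹ * (ρ⁻¹ * θ⁻¹) * q, ?_⟩
    have : v * w = algebraMap F _ (ρ⁻¹ * θ⁻¹) * (U * C) := by
      rw [hv, hw, mul_assoc, ← mul_assoc U, ← Algebra.commutes _ U, map_mul]
      simp only [mul_assoc]
    rw [this, map_mul _ (_ * _) q, ← hq', mul_assoc, ← mul_assoc (U * C),
      ← Algebra.commutes _ (U * C), map_mul _ (_ * _) (_ * _)]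
    simp only [mul_assoc]
  have hyy : v * w * (v * w) = v * v := by
    rw [mul_self_of_re_eq_zero (re_eq_zero_of_mul_self hyns hysc), redNorm_mul, hvN, hwN, mul_one,
      hvv]
  have hwvw : w * v * w = v := by
    have h1 : v * (v * (w * v * w)) = v * (v * v) := by
      rw [← hyy]; simp only [mul_assoc]
    rw [← mul_assoc, hvv, ← map_neg, ← Algebra.commutes _ v] at h1
    have h2 := congrArg (algebraMap F ℍ[F, A, B] (-e)⁻¹ * ·) h1
    have he : -e ≠ 0 := neg_ne_zero.2 D.ne_zero
    simpa only [← mul_assoc, ← map_mul, inv_mul_cancel₀ he, map_one, one_mul] using h2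
  refine ⟨hpos, v, w, mul_mem (hO.unit_inv_mem r) (u : ↥O).2,
    mul_mem (hO.unit_inv_mem t) (c : ↥O).2, hvv, hww, ?_⟩
  have h3 : v * (1 - w) = w * v := by
    conv_lhs => rw [← hwvw]
    rw [mul_assoc, mul_sub, mul_one, hww]
    simp
  rw [mul_sub, mul_one] at h3
  rw [sub_mul, one_mul, ← h3]; abel

/-- The units of an order with trivial image are those which are scalars. -/
lemma IsOrder.redUnit_map_eq_one_iff (hO : IsOrder F O) {G : Type*} [Group G] {φ : (↥O)ˣ →* G}
    (hφ : ∀ u, φ u = 1 ↔ IsScalarUnit F u) (u : (↥O)ˣ) :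
    φ u = 1 ↔ IsScalar ((u : ↥O) : ℍ[F, A, B]) := by
  rw [hφ, hO.isScalarUnit_iff]; rfl

theorem IsOrder.exists_isPair_of_map [CharZero F] (hO : IsOrder F O) (D : SmallUnitData σ₀ σ₁ ε)
    (hA₀ : σ₀ A < 0) (hB₀ : σ₀ B < 0) (hA₁ : σ₁ A < 0) (hB₁ : σ₁ B < 0)
    {G : Type*} [Group G] {φ : (↥O)ˣ →* G} (hs : Function.Surjective φ)
    (hφ : ∀ u, φ u = 1 ↔ IsScalarUnit F u) (u : (↥O)ˣ) (b : G)
    (hu : φ u ≠ 1) (hu2 : φ u * φ u = 1) (hb : b ≠ 1) (hb3 : b * b * b = 1)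
    (hub : φ u * b * φ u * b = 1)
    (hns : ∀ r : (𝓞 F)ˣ, redNorm F ((u : ↥O) : ℍ[F, A, B]) ≠ algebraMap (𝓞 F) F r ^ 2) :
    0 < σ₁ (algebraMap (𝓞 F) F ε) ∧ ∃ v w : ℍ[F, A, B], v ∈ O ∧ w ∈ O ∧
      IsPair (algebraMap F _ (algebraMap (𝓞 F) F ε)) v w := by
  obtain ⟨c, rfl⟩ := hs b
  simp only [← map_mul, ne_eq, hO.redUnit_map_eq_one_iff hφ] at hu hu2 hb hb3 hub
  exact hO.exists_isPair D hA₀ hB₀ hA₁ hB₁ u c hu hu2 hb hb3 hub hns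

theorem IsOrder.exists_isPair_of_dihedral_three [CharZero F] (hO : IsOrder F O)
    (D : SmallUnitData σ₀ σ₁ ε)
    (hA₀ : σ₀ A < 0) (hB₀ : σ₀ B < 0) (hA₁ : σ₁ A < 0) (hB₁ : σ₁ B < 0)
    (h : RedUnitDihedralSecondKind F 3 O) :
    0 < σ₁ (algebraMap (𝓞 F) F ε) ∧ ∃ v w : ℍ[F, A, B], v ∈ O ∧ w ∈ O ∧
      IsPair (algebraMap F _ (algebraMap (𝓞 F) F ε)) v w := by
  obtain ⟨φ, hs, hφ, u, hu, hu2, hns⟩ := h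
  have key : ∀ g : DihedralGroup 3, g ≠ 1 → g * g = 1 →
      g * DihedralGroup.r 1 * g * DihedralGroup.r 1 = 1 := by decide
  exact hO.exists_isPair_of_map D hA₀ hB₀ hA₁ hB₁ hs hφ u (DihedralGroup.r 1) hu hu2
    (by decide) (by decide) (key _ hu hu2) (hns u rfl)

theorem IsOrder.exists_isPair_of_perm_four [CharZero F] (hO : IsOrder F O)
    (D : SmallUnitData σ₀ σ₁ ε)
    (hA₀ : σ₀ A < 0) (hB₀ : σ₀ B < 0) (hA₁ : σ₁ A < 0) (hB₁ : σ₁ B < 0)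
    (h : RedUnitIso F O (Equiv.Perm (Fin 4))) :
    0 < σ₁ (algebraMap (𝓞 F) F ε) ∧ ∃ v w : ℍ[F, A, B], v ∈ O ∧ w ∈ O ∧
      IsPair (algebraMap F _ (algebraMap (𝓞 F) F ε)) v w := by
  obtain ⟨φ, hs, hφ⟩ := h
  obtain ⟨u, hu⟩ := hs (Equiv.swap 0 1)
  obtain ⟨c, hc⟩ := hs (Equiv.swap 0 2 * Equiv.swap 2 3)
  refine hO.exists_isPair_of_map D hA₀ hB₀ hA₁ hB₁ hs hφ u (Equiv.swap 0 1 * Equiv.swap 1 2)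
    (by rw [hu]; decide) (by rw [hu]; decide) (by decide) (by decide) (by rw [hu]; decide) ?_
  intro r hr
  have h1 : ¬IsScalar ((c : ↥O) : ℍ[F, A, B]) := by
    rw [← hO.redUnit_map_eq_one_iff hφ, hc]; decide
  have h2 : IsScalar (((c * c * c : (↥O)ˣ) : ↥O) : ℍ[F, A, B]) := by
    rw [← hO.redUnit_map_eq_one_iff hφ, map_mul, map_mul, hc]; decide
  obtain ⟨t, -, ht⟩ := hO.exists_redNorm_sq c h1 h2
  have h3 : ¬IsScalar (((c * u * (c * u) : (↥O)ˣ) : ↥O) : ℍ[F, A, B]) := by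
    rw [← hO.redUnit_map_eq_one_iff hφ, map_mul, map_mul, hc, hu]; decide
  have h4 : IsScalar (((c * u * (c * u) * (c * u * (c * u)) : (↥O)ˣ) : ↥O) : ℍ[F, A, B]) := by
    rw [← hO.redUnit_map_eq_one_iff hφ, map_mul, map_mul, map_mul, hc, hu]; decide
  have h5 := sq_trace_of_fourth_power (x := (((c * u : (↥O)ˣ) : ↥O) : ℍ[F, A, B])) h3 h4
  have h6 : redNorm F (((c * u : (↥O)ˣ) : ↥O) : ℍ[F, A, B]) =
      algebraMap (𝓞 F) F t ^ 2 * algebraMap (𝓞 F) F r ^ 2 := by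
    rw [← ht, ← hr, ← redNorm_mul]; rfl
  have ht0 : algebraMap (𝓞 F) F t ≠ 0 := by simp
  have hr0 : algebraMap (𝓞 F) F r ≠ 0 := by simp
  rw [h6] at h5
  apply D.sq_ne_two (2 * (((c * u : (↥O)ˣ) : ↥O) : ℍ[F, A, B]).re /
    (algebraMap (𝓞 F) F t * algebraMap (𝓞 F) F r))
  rw [div_pow, h5]; field_simp

theorem IsOrder.exists_isPair_of_dihedral_six [CharZero F] (hO : IsOrder F O)
    (D : SmallUnitData σ₀ σ₁ ε)
    (hA₀ : σ₀ A < 0) (hB₀ : σ₀ B < 0) (hA₁ : σ₁ A < 0) (hB₁ : σ₁ B < 0)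
    (h : RedUnitIso F O (DihedralGroup 6)) :
    0 < σ₁ (algebraMap (𝓞 F) F ε) ∧ ∃ v w : ℍ[F, A, B], v ∈ O ∧ w ∈ O ∧
      IsPair (algebraMap F _ (algebraMap (𝓞 F) F ε)) v w := by
  obtain ⟨φ, hs, hφ⟩ := h
  obtain ⟨u, hu⟩ := hs (.sr 0)
  obtain ⟨c, hc⟩ := hs (.sr 1)
  by_contra hcon
  have h1 : ∃ r : (𝓞 F)ˣ,
      redNorm F ((u : ↥O) : ℍ[F, A, B]) = algebraMap (𝓞 F) F r ^ 2 := by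
    by_contra! hns
    exact hcon (hO.exists_isPair_of_map D hA₀ hB₀ hA₁ hB₁ hs hφ u (.r 2) (by rw [hu]; decide)
      (by rw [hu]; decide) (by decide) (by decide) (by rw [hu]; decide) hns)
  have h2 : ∃ r : (𝓞 F)ˣ,
      redNorm F ((c : ↥O) : ℍ[F, A, B]) = algebraMap (𝓞 F) F r ^ 2 := by
    by_contra! hns
    exact hcon (hO.exists_isPair_of_map D hA₀ hB₀ hA₁ hB₁ hs hφ c (.r 2) (by rw [hc]; decide)
      (by rw [hc]; decide) (by decide) (by decide) (by rw [hc]; decide) hns)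
  obtain ⟨r, hr⟩ := h1
  obtain ⟨t, ht⟩ := h2
  have h2 : ¬IsScalar (((c * u * (c * u) : (↥O)ˣ) : ↥O) : ℍ[F, A, B]) := by
    rw [← hO.redUnit_map_eq_one_iff hφ, map_mul, map_mul, hc, hu]; decide
  have h3 : ¬IsScalar (((c * u * (c * u) * (c * u) : (↥O)ˣ) : ↥O) : ℍ[F, A, B]) := by
    rw [← hO.redUnit_map_eq_one_iff hφ, map_mul, map_mul, map_mul, hc, hu]; decide
  have h4 : IsScalar (((c * u * (c * u) * (c * u) * (c * u * (c * u) * (c * u)) : (↥O)ˣ) : ↥O) :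
      ℍ[F, A, B]) := by
    rw [← hO.redUnit_map_eq_one_iff hφ]; simp only [map_mul]; rw [hc, hu]; decide
  have h5 := sq_trace_of_sixth_power (x := (((c * u : (↥O)ˣ) : ↥O) : ℍ[F, A, B])) h2 h3 h4
  have h6 : redNorm F (((c * u : (↥O)ˣ) : ↥O) : ℍ[F, A, B]) =
      algebraMap (𝓞 F) F t ^ 2 * algebraMap (𝓞 F) F r ^ 2 := by
    rw [← ht, ← hr, ← redNorm_mul]; rfl
  have ht0 : algebraMap (𝓞 F) F t ≠ 0 := by simp
  have hr0 : algebraMap (𝓞 F) F r ≠ 0 := by simp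
  rw [h6] at h5
  apply D.sq_ne_three (2 * (((c * u : (↥O)ˣ) : ↥O) : ℍ[F, A, B]).re /
    (algebraMap (𝓞 F) F t * algebraMap (𝓞 F) F r))
  rw [div_pow, h5]; field_simp

/-- A pair realises an isomorphism with `(-e, -3)`. -/
theorem IsPair.nonempty_algEquiv [CharZero F] {e : F} (he₀ : 0 < σ₀ e) {v w : ℍ[F, A, B]}
    (hp : IsPair (algebraMap F _ e) v w) :
    Nonempty (ℍ[F, A, B] ≃ₐ[F] ℍ[F, -e, -3]) := by
  obtain ⟨h1, h2, h3⟩ := hp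
  let q : QuaternionAlgebra.Basis ℍ[F, A, B] (-e) 0 (-3) :=
    { i := v
      j := 2 * w - 1
      k := v * (2 * w - 1)
      i_mul_i := by rw [h1, Algebra.smul_def, mul_one, zero_smul, add_zero, map_neg]
      j_mul_j := by
        have : (2 * w - 1) * (2 * w - 1) = 4 * (w * w) - 4 * w + 1 := by noncomm_ring
        rw [this, h2, Algebra.smul_def, mul_one, map_neg, map_ofNat]
        noncomm_ring
        norm_num
      i_mul_j := rfl
      j_mul_i := by
        have : v * (2 * w - 1) = 2 * (v * w) - v := by noncomm_ring
        rw [this, h3, zero_smul]; noncomm_ring }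
  have hinj : Function.Injective q.liftHom := by
    rw [injective_iff_map_eq_zero]
    intro x hx
    apply eq_zero_of_redNorm_eq_zero (σ := σ₀) (by simpa using he₀)
        (by rw [map_neg, map_ofNat]; norm_num)
    have h4 : q.liftHom (x * star x) = 0 := by rw [map_mul, hx, zero_mul]
    rw [mul_star_eq, AlgHom.commutes] at h4
    exact (map_eq_zero_iff _ (algebraMap F ℍ[F, A, B]).injective).1 h4
  have hsurj : Function.Surjective q.liftHom :=
    (LinearMap.injective_iff_surjective_of_finrank_eq_finrank (f := q.liftHom.toLinearMap)
      (by rw [QuaternionAlgebra.finrank_eq_four, QuaternionAlgebra.finrank_eq_four])).1 hinj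
  exact ⟨(AlgEquiv.ofBijective q.liftHom ⟨hinj, hsurj⟩).symm⟩

end Extraction

section AbstractGroups

variable {Q : Type*} [Group Q]

/-- The homomorphism `ZMod n → Q` determined by an element whose order divides `n`. -/
def zmodPow (n : ℕ) (r : Q) (hr : r ^ n = 1) : ZMod n →+ Additive Q :=
  ZMod.lift n ⟨zmultiplesHom (Additive Q) (Additive.ofMul r), by simp [← ofMul_pow, hr]⟩

lemma zmodPow_intCast {n : ℕ} {r : Q} (hr : r ^ n = 1) (k : ℤ) :
    (zmodPow n r hr (k : ZMod n)).toMul = r ^ k := by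
  simp [zmodPow]

lemma zmodPow_conj {n : ℕ} {r s : Q} (hr : r ^ n = 1) (hs : s * s = 1) (hrs : s * r * s = r⁻¹)
    (i : ZMod n) : (zmodPow n r hr i).toMul * s = s * (zmodPow n r hr (-i)).toMul := by
  obtain ⟨k, rfl⟩ := ZMod.intCast_surjective i
  rw [← Int.cast_neg, zmodPow_intCast, zmodPow_intCast]
  have hs' : s⁻¹ = s := inv_eq_of_mul_eq_one_left hs
  have h1 : s * r * s⁻¹ = r⁻¹ := by rw [hs', hrs]
  have h2 : s * r ^ k * s⁻¹ = r ^ (-k) := by rw [← conj_zpow, h1, inv_zpow, zpow_neg]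
  rw [← h2, hs', ← mul_assoc, ← mul_assoc, hs, one_mul]

/-- The homomorphism from a dihedral group determined by a rotation and a reflection. -/
def dihedralHom (n : ℕ) (r s : Q) (hr : r ^ n = 1) (hs : s * s = 1) (hrs : s * r * s = r⁻¹) :
    DihedralGroup n →* Q where
  toFun
    | .r i => (zmodPow n r hr i).toMul
    | .sr i => s * (zmodPow n r hr i).toMul
  map_one' := by
    change (zmodPow n r hr 0).toMul = 1
    simp
  map_mul' := by
    have key := zmodPow_conj hr hs hrs
    rintro (i | i) (j | j)
    · simp only [DihedralGroup.r_mul_r, map_add, toMul_add]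
    · simp only [DihedralGroup.r_mul_sr]
      rw [← mul_assoc, key, mul_assoc, ← toMul_add, ← map_add, neg_add_eq_sub]
    · simp only [DihedralGroup.sr_mul_r, map_add, toMul_add, mul_assoc]
    · simp only [DihedralGroup.sr_mul_sr]
      rw [mul_assoc, ← mul_assoc _ s, key, mul_assoc s, ← mul_assoc s s, hs, one_mul, ← toMul_add,
        ← map_add, neg_add_eq_sub]

section

variable {n : ℕ} {r s : Q} (hr : r ^ n = 1) (hs : s * s = 1) (hrs : s * r * s = r⁻¹)

lemma dihedralHom_r_intCast (k : ℤ) : dihedralHom n r s hr hs hrs (.r k) = r ^ k :=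
  zmodPow_intCast hr k

lemma dihedralHom_sr_intCast (k : ℤ) : dihedralHom n r s hr hs hrs (.sr k) = s * r ^ k :=
  congrArg (s * ·) (zmodPow_intCast hr k)

lemma dihedralHom_r_one : dihedralHom n r s hr hs hrs (.r 1) = r := by
  have := dihedralHom_r_intCast hr hs hrs 1
  rwa [Int.cast_one, zpow_one] at this

lemma dihedralHom_sr_zero : dihedralHom n r s hr hs hrs (.sr 0) = s := by
  have := dihedralHom_sr_intCast hr hs hrs 0
  rwa [Int.cast_zero, zpow_zero, mul_one] at this

lemma dihedralHom_injective (hn : orderOf r = n) (hsr : s ∉ Subgroup.zpowers r) :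
    Function.Injective (dihedralHom n r s hr hs hrs) := by
  rw [injective_iff_map_eq_one]
  rintro (i | i) h
  · obtain ⟨k, rfl⟩ := ZMod.intCast_surjective i
    rw [dihedralHom_r_intCast] at h
    rw [(ZMod.intCast_zmod_eq_zero_iff_dvd k n).2 (hn ▸ orderOf_dvd_iff_zpow_eq_one.2 h)]
    rfl
  · obtain ⟨k, rfl⟩ := ZMod.intCast_surjective i
    rw [dihedralHom_sr_intCast] at h
    exact absurd (eq_inv_of_mul_eq_one_left h ▸ inv_mem (zpow_mem (Subgroup.mem_zpowers r) k)) hsr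

lemma dihedralHom_surjective (h : ∀ q, q ∈ Subgroup.zpowers r ∨ q * s ∈ Subgroup.zpowers r) :
    Function.Surjective (dihedralHom n r s hr hs hrs) := by
  intro q
  rcases h q with ⟨k, hk⟩ | ⟨k, hk⟩
  · exact ⟨.r k, by rw [dihedralHom_r_intCast]; exact hk⟩
  · refine ⟨.r k * .sr 0, ?_⟩
    rw [map_mul, dihedralHom_r_intCast, dihedralHom_sr_zero]
    have hk' : r ^ k = q * s := hk
    rw [hk', mul_assoc, hs, mul_one]

end

lemma index_eq_four (f : DihedralGroup 3 →* Q) (y : Q) (hy : y ∉ f.range)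
    (hyb : y⁻¹ * f (.r 1) * y ∉ f.range)
    (hq : ∀ q, q ∈ f.range ∨ ∃ k, (f (.r k) * y)⁻¹ * q ∈ f.range) :
    Nat.card (Q ⧸ f.range) = 4 := by
  let g : Option (ZMod 3) → Q ⧸ f.range := fun o =>
    o.elim ((1 : Q) : Q ⧸ f.range) (fun k => ((f (.r k) * y : Q) : Q ⧸ f.range))
  have hkey : ∀ k, f (.r k) * y ∉ f.range := fun k h =>
    hy (by simpa using mul_mem (inv_mem (MonoidHom.mem_range.2 ⟨DihedralGroup.r k, rfl⟩)) h)
  have hg : Function.Bijective g := by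
    constructor
    · rintro (_ | k) (_ | l) h
      · rfl
      · have h' := QuotientGroup.eq.1 h
        rw [inv_one, one_mul] at h'
        exact absurd h' (hkey l)
      · have h' := QuotientGroup.eq.1 h.symm
        rw [inv_one, one_mul] at h'
        exact absurd h' (hkey k)
      · have h' := QuotientGroup.eq.1 h
        have h1 : y⁻¹ * f (.r (l - k)) * y ∈ f.range := by
          convert h' using 1
          rw [mul_inv_rev, ← map_inv, DihedralGroup.inv_r, mul_assoc, mul_assoc,
            ← mul_assoc (f _) (f _),
            ← map_mul, DihedralGroup.r_mul_r, neg_add_eq_sub]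
        generalize hm : l - k = m at h1
        have hm3 : m = 0 ∨ m = 1 ∨ m = -1 := by clear hm h1; revert m; decide
        rcases hm3 with rfl | rfl | rfl
        · rw [sub_eq_zero.1 hm]
        · exact absurd h1 hyb
        · refine absurd (inv_mem h1) ?_
          rwa [mul_inv_rev, mul_inv_rev, inv_inv, ← map_inv, DihedralGroup.inv_r, neg_neg,
            ← mul_assoc]
    · intro z
      obtain ⟨q, rfl⟩ := QuotientGroup.mk_surjective z
      rcases hq q with h | ⟨k, h⟩
      · exact ⟨none, QuotientGroup.eq.2 (by rwa [inv_one, one_mul])⟩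
      · exact ⟨some k, QuotientGroup.eq.2 h⟩
  rw [← Nat.card_congr (Equiv.ofBijective g hg)]
  simp

lemma normalCore_eq_bot (f : DihedralGroup 3 →* Q) (y : Q)
    (hyb : y⁻¹ * f (.r 1) * y ∉ f.range) : f.range.normalCore = ⊥ := by
  rw [Subgroup.eq_bot_iff_forall]
  intro x hx
  obtain ⟨z, rfl⟩ := Subgroup.normalCore_le _ hx
  by_contra hz
  have hz1 : z ≠ 1 := fun h => hz (by rw [h, map_one])
  have hgen : ∃ k : ℕ, z ^ k * (.r 1 * z⁻¹ * (.r 1)⁻¹) = .r 1 := by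
    have : ∀ z : DihedralGroup 3, z ≠ 1 →
        ∃ k : Fin 6, z ^ k.1 * (.r 1 * z⁻¹ * (.r 1)⁻¹) = .r 1 := by
      decide
    obtain ⟨k, hk⟩ := this z hz1
    exact ⟨k, hk⟩
  obtain ⟨k, hk⟩ := hgen
  have hN : f.range.normalCore.Normal := inferInstance
  have h1 : f (.r 1) ∈ f.range.normalCore := by
    rw [← hk, map_mul, map_pow, map_mul, map_mul, map_inv, map_inv]
    exact mul_mem (pow_mem hx k) (hN.conj_mem _ (inv_mem hx) _)
  have h2 := Subgroup.normalCore_le _ (hN.conj_mem _ h1 y⁻¹)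
  rw [inv_inv] at h2
  exact hyb h2

/-- A group acting faithfully on the four cosets of a dihedral subgroup of order six. -/
theorem nonempty_mulEquiv_perm_four (f : DihedralGroup 3 →* Q) (hf : Function.Injective f) (y : Q)
    (hy : y ∉ f.range) (hyb : y⁻¹ * f (.r 1) * y ∉ f.range)
    (hq : ∀ q, q ∈ f.range ∨ ∃ k, (f (.r k) * y)⁻¹ * q ∈ f.range) :
    Nonempty (Q ≃* Equiv.Perm (Fin 4)) := by
  have h4 := index_eq_four f y hy hyb hq
  have h6 : Nat.card f.range = 6 := by
    rw [← Nat.card_congr (MonoidHom.ofInjective hf).toEquiv, DihedralGroup.nat_card]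
  have h24 : Nat.card Q = 24 := by
    rw [Subgroup.card_eq_card_quotient_mul_card_subgroup f.range, h4, h6]
  have hfin : Finite (Q ⧸ f.range) := Nat.finite_of_card_ne_zero (by omega)
  have hfinQ : Finite Q := Nat.finite_of_card_ne_zero (by omega)
  have hinj : Function.Injective (MulAction.toPermHom Q (Q ⧸ f.range)) := by
    rw [← MonoidHom.ker_eq_bot_iff, ← Subgroup.normalCore_eq_ker, normalCore_eq_bot f y hyb]
  have e : Q ⧸ f.range ≃ Fin 4 := (Finite.equivFinOfCardEq h4)
  have hbij : Function.Bijective (MulAction.toPermHom Q (Q ⧸ f.range)) := by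
    refine (Nat.bijective_iff_injective_and_card _).2 ⟨hinj, ?_⟩
    rw [h24, Nat.card_congr (Equiv.permCongr e), Nat.card_eq_fintype_card, Fintype.card_perm]
    rfl
  exact ⟨(MulEquiv.ofBijective _ hbij).trans (Equiv.permCongrHom e)⟩

end AbstractGroups

section StandardGenerators

variable {F : Type} [Field F]

/-- The generator `i` of `(-e, -3)`. -/
def quatI (e : F) : ℍ[F, -e, -3] := ⟨0, 1, 0, 0⟩

/-- The sixth root of unity `(1 + j) / 2` of `(-e, -3)`. -/
def quatEta (e : F) : ℍ[F, -e, -3] := (2 : F)⁻¹ • (1 + (⟨0, 0, 1, 0⟩ : ℍ[F, -e, -3]))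

variable {e : F}

@[simp] lemma quatI_re : (quatI e).re = 0 := rfl
@[simp] lemma quatI_imI : (quatI e).imI = 1 := rfl
@[simp] lemma quatI_imJ : (quatI e).imJ = 0 := rfl
@[simp] lemma quatI_imK : (quatI e).imK = 0 := rfl
@[simp] lemma quatEta_re : (quatEta e).re = 2⁻¹ := by simp [quatEta]
@[simp] lemma quatEta_imI : (quatEta e).imI = 0 := by simp [quatEta]
@[simp] lemma quatEta_imJ : (quatEta e).imJ = 2⁻¹ := by simp [quatEta]
@[simp] lemma quatEta_imK : (quatEta e).imK = 0 := by simp [quatEta]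

lemma redNorm_quatI : redNorm F (quatI e) = e := by simp [redNorm_eq]

lemma redNorm_quatEta [CharZero F] : redNorm F (quatEta e) = 1 := by
  simp only [redNorm_eq, quatEta_re, quatEta_imI, quatEta_imJ, quatEta_imK]
  field_simp; norm_num

lemma quatI_mul_self : quatI e * quatI e = -algebraMap F _ e := by
  rw [mul_self_of_re_eq_zero quatI_re, redNorm_quatI]

lemma quatEta_mul_self [CharZero F] : quatEta e * quatEta e = quatEta e - 1 := by
  rw [mul_self_eq, redNorm_quatEta, quatEta_re, mul_inv_cancel₀ two_ne_zero]; simp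

lemma quatI_mul_quatEta [CharZero F] : quatI e * quatEta e = (1 - quatEta e) * quatI e := by
  ext <;> simp
  all_goals field_simp
  all_goals norm_num

lemma isPair_standard [CharZero F] : IsPair (algebraMap F _ e) (quatI e) (quatEta e) :=
  ⟨quatI_mul_self, quatEta_mul_self, quatI_mul_quatEta⟩

lemma quatEta_pow_three [CharZero F] : quatEta e ^ 3 = -1 := by
  have : quatEta e ^ 3 = quatEta e * (quatEta e * quatEta e) := by noncomm_ring
  rw [this, quatEta_mul_self, mul_sub, quatEta_mul_self]; noncomm_ring

lemma quatEta_pow_imI_imK (k : ℕ) : (quatEta e ^ k).imI = 0 ∧ (quatEta e ^ k).imK = 0 := by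
  induction k with
  | zero => simp
  | succ k ih => rw [pow_succ]; simp [ih.1, ih.2]

/-- The contribution of the `F(j)`-component of `x` to its reduced norm. -/
def normRe (x : ℍ[F, -e, -3]) : F := x.re ^ 2 + 3 * x.imJ ^ 2

/-- The contribution of the `F(j)i`-component of `x` to its reduced norm. -/
def normIm (x : ℍ[F, -e, -3]) : F := e * (x.imI ^ 2 + 3 * x.imK ^ 2)

lemma redNorm_eq_add (x : ℍ[F, -e, -3]) : redNorm F x = normRe x + normIm x := by
  rw [redNorm_eq, normRe, normIm]; ring

lemma normRe_sum [CharZero F] (x y : ℍ[F, -e, -3]) :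
    normRe (star y * x) + normRe (star y * (star (quatEta e) * x)) +
      normRe (star y * (star (quatEta e) * (star (quatEta e) * x))) =
      3 * (normRe x * normRe y + normIm x * normIm y) := by
  simp [normRe, normIm]
  field_simp
  ring

lemma normRe_conj [CharZero F] (y : ℍ[F, -e, -3]) :
    normRe (star y * quatEta e * y) = normRe y ^ 2 + normIm y ^ 2 - normRe y * normIm y := by
  simp [normRe, normIm]
  field_simp
  ring

lemma normRe_mul_of_re_eq_zero {z : ℍ[F, -e, -3]} (h0 : z.re = 0) (h2 : z.imJ = 0)
    (y : ℍ[F, -e, -3]) : normRe (y * z) = normIm y * normIm z := by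
  simp [normRe, normIm, h0, h2]
  ring

/-- An order of `(-e, -3)` containing the standard generators, with `e` the fundamental unit of
the base field, positive at both places. -/
structure OverOrder (σ₀ σ₁ : F →+* ℝ) (ε : (𝓞 F)ˣ) (e : F) (O : Subring ℍ[F, -e, -3]) : Prop where
  data : SmallUnitData σ₀ σ₁ ε
  eq : algebraMap (𝓞 F) F ε = e
  pos : 0 < σ₁ e
  isOrder : IsOrder F O
  quatI_mem : quatI e ∈ O
  quatEta_mem : quatEta e ∈ O

variable {σ₀ σ₁ : F →+* ℝ} {ε : (𝓞 F)ˣ} {O : Subring ℍ[F, -e, -3]}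

lemma OverOrder.ne_zero (h : OverOrder σ₀ σ₁ ε e O) : e ≠ 0 := by
  rw [← h.eq]; simp

lemma OverOrder.neg₀ (h : OverOrder σ₀ σ₁ ε e O) : σ₀ (-e) < 0 := by
  rw [map_neg, neg_lt_zero, ← h.eq]; exact h.data.pos

lemma OverOrder.neg₁ (h : OverOrder σ₀ σ₁ ε e O) : σ₁ (-e) < 0 := by
  rw [map_neg, neg_lt_zero]; exact h.pos

lemma map_neg_three_lt (σ : F →+* ℝ) : σ (-3) < 0 := by
  rw [map_neg, map_ofNat]; norm_num

lemma OverOrder.algebraMap_inv_mem (h : OverOrder σ₀ σ₁ ε e O) : algebraMap F _ e⁻¹ ∈ O := by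
  have := h.isOrder.unit_inv_mem ε
  rwa [h.eq] at this

lemma OverOrder.abs_trace_le (h : OverOrder σ₀ σ₁ ε e O) {x : ℍ[F, -e, -3]}
    (hN : redNorm F x = 1) : |σ₀ (2 * x.re)| ≤ 2 ∧ |σ₁ (2 * x.re)| ≤ 2 := by
  have h0 := sq_re_le_redNorm h.neg₀ (map_neg_three_lt σ₀) x
  have h1 := sq_re_le_redNorm h.neg₁ (map_neg_three_lt σ₁) x
  rw [hN, map_one] at h0 h1
  rw [map_mul, map_mul, map_ofNat, map_ofNat, abs_mul, abs_mul, abs_two]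
  constructor
  · linarith [(sq_le_one_iff_abs_le_one _).1 h0]
  · linarith [(sq_le_one_iff_abs_le_one _).1 h1]

lemma OverOrder.exists_trace_eq (h : OverOrder σ₀ σ₁ ε e O) {x : ℍ[F, -e, -3]} (hx : x ∈ O)
    (hN : redNorm F x = 1) : ∃ n : ℤ, 2 * x.re = n ∧ -2 ≤ n ∧ n ≤ 2 :=
  h.data.exists_int_eq _ (h.isOrder.trace_integral hx) (h.abs_trace_le hN).1 (h.abs_trace_le hN).2

lemma OverOrder.eq_zero_of_normIm (h : OverOrder σ₀ σ₁ ε e O) {x : ℍ[F, -e, -3]}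
    (hx : normIm x = 0) : x.imI = 0 ∧ x.imK = 0 := by
  have h1 : x.imI ^ 2 + 3 * x.imK ^ 2 = 0 := (mul_eq_zero.1 hx).resolve_left h.ne_zero
  have h2 := congrArg σ₀ h1
  simp only [map_add, map_mul, map_pow, map_ofNat, map_zero] at h2
  constructor
  · have : σ₀ x.imI = 0 := by nlinarith [sq_nonneg (σ₀ x.imI), sq_nonneg (σ₀ x.imK)]
    simpa using this
  · have : σ₀ x.imK = 0 := by nlinarith [sq_nonneg (σ₀ x.imI), sq_nonneg (σ₀ x.imK)]
    simpa using this

/-- The elements of norm one are in `F(j)i`, in a third position, or powers of `(1 + j) / 2`. -/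
theorem OverOrder.trichotomy [CharZero F] (h : OverOrder σ₀ σ₁ ε e O) {x : ℍ[F, -e, -3]}
    (hx : x ∈ O) (hN : redNorm F x = 1) :
    (x.re = 0 ∧ x.imJ = 0) ∨ 3 * normRe x = 1 ∨ ∃ k : ℕ, x = quatEta e ^ k := by
  obtain ⟨n, hn, hn1, hn2⟩ := h.exists_trace_eq hx hN
  obtain ⟨m, hm, hm1, hm2⟩ := h.exists_trace_eq (mul_mem h.quatEta_mem hx)
    (by rw [redNorm_mul, redNorm_quatEta, hN, one_mul])
  have hx0 : x.re = n / 2 := by rw [← hn]; field_simp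
  have hx2 : x.imJ = (n / 2 - m) / 3 := by
    rw [← hm, ← hx0]
    simp only [QuaternionAlgebra.re_mul, quatEta_re, quatEta_imI, quatEta_imJ, quatEta_imK]
    field_simp; ring
  have hV : 3 * normRe x = ((n ^ 2 - n * m + m ^ 2 : ℤ) : F) := by
    rw [normRe, hx0, hx2]; push_cast; field_simp; ring
  have hIm := redNorm_eq_add x
  rw [hN] at hIm
  have hle : n ^ 2 - n * m + m ^ 2 ≤ 3 := by
    have h1 : (0 : ℝ) ≤ σ₀ (normIm x) := by
      have he := h.neg₀
      rw [map_neg, neg_lt_zero] at he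
      simp only [normIm, map_mul, map_add, map_pow, map_ofNat]
      positivity
    have h2 := congrArg σ₀ hV
    have h3 := congrArg σ₀ hIm
    simp only [map_mul, map_add, map_ofNat, map_intCast, map_one] at h2 h3
    have : ((n ^ 2 - n * m + m ^ 2 : ℤ) : ℝ) ≤ 3 := by linarith
    exact_mod_cast this
  have key : (n = 0 ∧ m = 0) ∨ n ^ 2 - n * m + m ^ 2 = 1 ∨
      (n ^ 2 - n * m + m ^ 2 = 3 ∧ ((n = 2 ∧ m = 1) ∨ (n = 1 ∧ m = -1) ∨ (n = -1 ∧ m = -2) ∨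
        (n = -2 ∧ m = -1) ∨ (n = -1 ∧ m = 1) ∨ (n = 1 ∧ m = 2))) := by
    clear * - hn1 hn2 hm1 hm2 hle
    interval_cases n <;> interval_cases m <;> omega
  rcases key with ⟨rfl, rfl⟩ | h1 | ⟨h1, h2⟩
  · left; simp [hx0, hx2]
  · right; left; rw [hV, h1, Int.cast_one]
  · right; right
    have h3 : normRe x = 1 := by
      rw [h1] at hV
      have h4 : (3 : F) * normRe x = 3 * 1 := by rw [hV]; norm_num
      exact mul_left_cancel₀ three_ne_zero h4
    obtain ⟨i0, k0⟩ := h.eq_zero_of_normIm (x := x) (by linear_combination -h3 - hIm)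
    have e2 : quatEta e ^ 2 = quatEta e - 1 := by rw [sq, quatEta_mul_self]
    have e4 : quatEta e ^ 4 = -quatEta e := by
      rw [show 4 = 3 + 1 from rfl, pow_succ, quatEta_pow_three, neg_one_mul]
    have e5 : quatEta e ^ 5 = 1 - quatEta e := by
      rw [show 5 = 3 + 2 from rfl, pow_add, quatEta_pow_three, e2, neg_one_mul, neg_sub]
    rcases h2 with ⟨rfl, rfl⟩ | ⟨rfl, rfl⟩ | ⟨rfl, rfl⟩ | ⟨rfl, rfl⟩ | ⟨rfl, rfl⟩ | ⟨rfl, rfl⟩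
    · refine ⟨0, ?_⟩
      rw [pow_zero]
      ext <;> simp [hx0, hx2, i0, k0]
    · refine ⟨1, ?_⟩
      rw [pow_one]
      ext <;> simp [hx0, hx2, i0, k0]
      all_goals norm_num
    · refine ⟨2, ?_⟩
      rw [e2]
      ext <;> simp [hx0, hx2, i0, k0]
      all_goals norm_num
    · refine ⟨3, ?_⟩
      rw [quatEta_pow_three]
      ext <;> simp [hx0, hx2, i0, k0]
    · refine ⟨4, ?_⟩
      rw [e4]
      ext <;> simp [hx0, hx2, i0, k0]
      all_goals norm_num
    · refine ⟨5, ?_⟩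
      rw [e5]
      ext <;> simp [hx0, hx2, i0, k0]
      all_goals norm_num

lemma OverOrder.eq_quatEta_pow [CharZero F] (h : OverOrder σ₀ σ₁ ε e O) {x : ℍ[F, -e, -3]}
    (hx : x ∈ O) (hN : redNorm F x = 1) (h1 : x.imI = 0) (h3 : x.imK = 0) :
    ∃ k : ℕ, x = quatEta e ^ k := by
  have hR : normRe x = 1 := by
    have := redNorm_eq_add x
    rw [hN] at this
    simp [normIm, h1, h3] at this
    exact this.symm
  rcases h.trichotomy hx hN with ⟨h0, h2⟩ | hx | hx
  · simp [normRe, h0, h2] at hR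
  · rw [hR] at hx; norm_num at hx
  · exact hx

/-- Norm one elements inside `F(j)i` and in the third position do not coexist. -/
lemma OverOrder.not_both [CharZero F] (h : OverOrder σ₀ σ₁ ε e O) {y z : ℍ[F, -e, -3]}
    (hy : y ∈ O) (hyN : redNorm F y = 1) (hy1 : 3 * normRe y = 1)
    (hz : z ∈ O) (hzN : redNorm F z = 1) (h0 : z.re = 0) (h2 : z.imJ = 0) : False := by
  have h1 := normRe_mul_of_re_eq_zero h0 h2 y
  have hzR : normRe z = 0 := by simp [normRe, h0, h2]
  rw [redNorm_eq_add] at hyN hzN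
  have hval : 3 * normRe (y * z) = 2 := by
    rw [h1]
    have : normIm z = 1 := by rw [← hzN, hzR, zero_add]
    rw [this]; linear_combination 3 * hyN - hy1
  rw [← redNorm_eq_add] at hyN hzN
  have hN : redNorm F (y * z) = 1 := by rw [redNorm_mul, hyN, hzN, one_mul]
  rcases h.trichotomy (mul_mem hy hz) hN with ⟨h0, h2⟩ | h3 | ⟨k, hk⟩
  · simp [normRe, h0, h2] at hval
  · rw [hval] at h3; norm_num at h3
  · have h4 := redNorm_eq_add (y * z)
    rw [hN, hk, normIm, (quatEta_pow_imI_imK k).1, (quatEta_pow_imI_imK k).2, ← hk] at h4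
    have h5 : normRe (y * z) = 1 := by rw [h4]; ring
    rw [h5] at hval; norm_num at hval

end StandardGenerators

section ReducedUnits

variable {F : Type} [Field F] {A B : F}

/-- The units of `O` which lie in the base field. -/
def scalarUnits (O : Subring ℍ[F, A, B]) : Subgroup (↥O)ˣ :=
  (Units.map (algebraMap F ℍ[F, A, B]).toMonoidHom).range.comap (Units.map O.subtype.toMonoidHom)

variable {O : Subring ℍ[F, A, B]}

lemma mem_scalarUnits {u : (↥O)ˣ} : u ∈ scalarUnits O ↔ IsScalar ((u : ↥O) : ℍ[F, A, B]) := by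
  constructor
  · rintro ⟨r, hr⟩
    exact ⟨r, (congrArg Units.val hr).symm⟩
  · rintro ⟨r, hr⟩
    have hr0 : r ≠ 0 := by
      rintro rfl
      rw [map_zero] at hr
      exact coe_unit_ne_zero u hr
    exact ⟨Units.mk0 r hr0, Units.ext hr.symm⟩

instance : (scalarUnits O).Normal where
  conj_mem u hu v := by
    rw [mem_scalarUnits] at hu ⊢
    obtain ⟨r, hr⟩ := hu
    refine ⟨r, ?_⟩
    rw [Units.val_mul, Units.val_mul, Subring.coe_mul, Subring.coe_mul, hr, ← Algebra.commutes,
      mul_assoc, ← Subring.coe_mul, Units.mul_inv, Subring.coe_one, mul_one]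

/-- The class of a unit in the reduced unit group. -/
def redMk (O : Subring ℍ[F, A, B]) : (↥O)ˣ →* (↥O)ˣ ⧸ scalarUnits O :=
  QuotientGroup.mk' (scalarUnits O)

lemma redMk_surjective : Function.Surjective (redMk O) :=
  QuotientGroup.mk'_surjective _

lemma redMk_eq_one {u : (↥O)ˣ} : redMk O u = 1 ↔ IsScalar ((u : ↥O) : ℍ[F, A, B]) :=
  (QuotientGroup.eq_one_iff u).trans mem_scalarUnits

lemma redMk_eq_of_mul {u v : (↥O)ˣ} {r : F}
    (h : ((u : ↥O) : ℍ[F, A, B]) = algebraMap F _ r * ((v : ↥O) : ℍ[F, A, B])) :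
    redMk O u = redMk O v := by
  rw [← mul_inv_eq_one, ← map_inv, ← map_mul, redMk_eq_one]
  refine ⟨r, ?_⟩
  rw [Units.val_mul, Subring.coe_mul, h, mul_assoc, ← Subring.coe_mul, Units.mul_inv,
    Subring.coe_one, mul_one]

lemma exists_eq_of_redMk_eq {u v : (↥O)ˣ} (h : redMk O u = redMk O v) :
    ∃ r : F, ((u : ↥O) : ℍ[F, A, B]) = algebraMap F _ r * ((v : ↥O) : ℍ[F, A, B]) := by
  rw [← mul_inv_eq_one, ← map_inv, ← map_mul, redMk_eq_one] at h
  obtain ⟨r, hr⟩ := h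
  refine ⟨r, ?_⟩
  rw [← hr, ← Subring.coe_mul, ← Units.val_mul, inv_mul_cancel_right]

/-- The inverse of a unit of reduced norm one is its conjugate. -/
lemma coe_inv_eq_star {u : (↥O)ˣ} (h : redNorm F ((u : ↥O) : ℍ[F, A, B]) = 1) :
    (((u⁻¹ : (↥O)ˣ) : ↥O) : ℍ[F, A, B]) = star ((u : ↥O) : ℍ[F, A, B]) := by
  have h1 : star ((u : ↥O) : ℍ[F, A, B]) * ((u : ↥O) : ℍ[F, A, B]) = 1 := by
    rw [star_mul_eq, h, map_one]
  have h2 : ((u : ↥O) : ℍ[F, A, B]) * (((u⁻¹ : (↥O)ˣ) : ↥O) : ℍ[F, A, B]) = 1 := by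
    rw [← Subring.coe_mul, Units.mul_inv, Subring.coe_one]
  exact (left_inv_eq_right_inv h1 h2).symm

lemma IsOrder.redUnitIso_of_mulEquiv (hO : IsOrder F O) {G : Type*} [Group G]
    (f : (↥O)ˣ ⧸ scalarUnits O ≃* G) : RedUnitIso F O G := by
  refine ⟨f.toMonoidHom.comp (redMk O), f.surjective.comp redMk_surjective, fun u => ?_⟩
  rw [hO.isScalarUnit_iff]
  change f (redMk O u) = 1 ↔ _
  rw [EmbeddingLike.map_eq_one_iff]
  exact redMk_eq_one

/-- An involution inverting an element of order three is no power of an element commuting with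
the latter. -/
lemma notMem_zpowers_of_commute {Q : Type*} [Group Q] {r s c : Q} (hr : orderOf r = 3)
    (hs : s * s = 1) (hrs : s * r * s = r⁻¹) (hc : Commute c r) : s ∉ Subgroup.zpowers c := by
  rintro ⟨k, hk⟩
  have h1 : Commute s r := hk ▸ hc.zpow_left k
  rw [h1.eq, mul_assoc, hs, mul_one] at hrs
  have h2 : r ^ 2 = 1 := by rw [sq]; nth_rewrite 1 [hrs]; exact inv_mul_cancel r
  have h3 := orderOf_dvd_of_pow_eq_one h2
  rw [hr] at h3
  norm_num at h3

/-- A criterion for a group to be dihedral of order twelve. -/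
theorem nonempty_mulEquiv_dihedral_six {Q : Type*} [Group Q] {r s p : Q} (hr : orderOf r = 3)
    (hs : s * s = 1) (hrs : s * r * s = r⁻¹) (hpr : Commute p r) (hps : s * p * s = p⁻¹) {m : ℕ}
    (hp : p * p = r ^ m) (hpm : p * r ^ m ≠ 1)
    (hQ : ∀ q, ∃ x, (q = x ∨ q * s = x) ∧
      (x ∈ Subgroup.zpowers r ∨ x * s * p⁻¹ ∈ Subgroup.zpowers r)) :
    Nonempty (Q ≃* DihedralGroup 6) := by
  have hr3 : r ^ 3 = 1 := by rw [← hr, pow_orderOf_eq_one]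
  have hsi : s⁻¹ = s := inv_eq_of_mul_eq_one_left hs
  have hc₀2 : (p * r ^ m) ^ 2 = 1 := by
    rw [(hpr.pow_right m).mul_pow, sq p, hp, ← pow_mul, ← pow_add,
      show m + m * 2 = 3 * m by ring, pow_mul, hr3, one_pow]
  have hcr : Commute (p * r ^ m) r := hpr.mul_left ((Commute.refl r).pow_left m)
  have hord₀ := orderOf_eq_prime hc₀2 hpm
  have hord : orderOf (p * r ^ m * r) = 6 := by
    rw [hcr.orderOf_mul_eq_mul_orderOf_of_coprime (by rw [hord₀, hr]; norm_num), hord₀, hr]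
  have hcomm : Commute (p * r ^ m * r) r := hcr.mul_left (Commute.refl r)
  have hpow : p * r ^ m * r = p * r ^ (m + 1) := by rw [mul_assoc, pow_succ]
  have hrmem : r ∈ Subgroup.zpowers (p * r ^ m * r) := by
    have : (p * r ^ m * r) ^ 4 = r := by
      rw [hcr.mul_pow, show 4 = 2 * 2 from rfl, pow_mul, hc₀2, one_pow, one_mul,
        show 2 * 2 = 3 + 1 from rfl, pow_succ, hr3, one_mul]
    have h4 := Subgroup.npow_mem_zpowers (p * r ^ m * r) 4
    rwa [this] at h4
  have hle : Subgroup.zpowers r ≤ Subgroup.zpowers (p * r ^ m * r) := by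
    rwa [Subgroup.zpowers_le]
  have hpmem : p ∈ Subgroup.zpowers (p * r ^ m * r) := by
    have h1 : (p * r ^ m * r) * (r ^ (m + 1))⁻¹ = p := by rw [hpow, mul_inv_cancel_right]
    have h2 := mul_mem (Subgroup.mem_zpowers (p * r ^ m * r)) (inv_mem (pow_mem hrmem (m + 1)))
    rwa [h1] at h2
  have hconj : s * (p * r ^ m * r) * s = (p * r ^ m * r)⁻¹ := by
    have h1 : s * r ^ (m + 1) * s = (r ^ (m + 1))⁻¹ := by
      nth_rewrite 2 [← hsi]
      rw [← conj_pow, hsi, hrs, inv_pow]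
    calc s * (p * r ^ m * r) * s = s * p * (s * s) * r ^ (m + 1) * s := by
          rw [hpow, hs, mul_one, mul_assoc s p]
      _ = (s * p * s) * (s * r ^ (m + 1) * s) := by simp only [mul_assoc]
      _ = (p * r ^ m * r)⁻¹ := by
          rw [hps, h1, hpow, (hpr.pow_right (m + 1)).eq, mul_inv_rev]
  have hc6 : (p * r ^ m * r) ^ 6 = 1 := by rw [← hord, pow_orderOf_eq_one]
  refine ⟨(MulEquiv.ofBijective (dihedralHom 6 (p * r ^ m * r) s hc6 hs hconj)
    ⟨dihedralHom_injective _ _ _ hord (notMem_zpowers_of_commute hr hs hrs hcomm),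
      dihedralHom_surjective _ _ _ fun q => ?_⟩).symm⟩
  obtain ⟨x, hq, hx⟩ := hQ q
  have hx' : x ∈ Subgroup.zpowers (p * r ^ m * r) ∨ x * s ∈ Subgroup.zpowers (p * r ^ m * r) := by
    refine hx.imp (@hle _) fun h => ?_
    rw [← inv_mul_cancel_right (x * s) p]
    exact mul_mem (hle h) hpmem
  rcases hq with rfl | rfl
  · exact hx'
  · rw [mul_assoc q s s, hs, mul_one] at hx'
    exact hx'.symm

end ReducedUnits

section Classification

variable {F : Type} [Field F] {e : F} {σ₀ σ₁ : F →+* ℝ} {ε : (𝓞 F)ˣ}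
  {O : Subring ℍ[F, -e, -3]} {a b : (↥O)ˣ}

/-- The units `i` and `(1 + j) / 2` of the order `O`. -/
structure IsGenPair (e : F) (O : Subring ℍ[F, -e, -3]) (a b : (↥O)ˣ) : Prop where
  left : ((a : ↥O) : ℍ[F, -e, -3]) = quatI e
  right : ((b : ↥O) : ℍ[F, -e, -3]) = quatEta e

lemma SmallUnitData.ne_sq_field (D : SmallUnitData σ₀ σ₁ ε) (q : F) :
    algebraMap (𝓞 F) F ε ≠ q ^ 2 := by
  intro hq
  have h1 : IsIntegral ℤ q := IsIntegral.of_pow two_pos (hq ▸ (ε : 𝓞 F).2)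
  obtain ⟨r, hr⟩ := exists_unit_of_isIntegral h1 (h1.mul ((ε⁻¹ : (𝓞 F)ˣ) : 𝓞 F).2) (by
    change q * (q * algebraMap (𝓞 F) F (ε⁻¹ : (𝓞 F)ˣ)) = 1
    rw [map_units_inv, ← mul_assoc, ← sq, ← hq, mul_inv_cancel₀ D.ne_zero])
  refine D.ne_sq r (Units.ext ((FaithfulSMul.algebraMap_injective (𝓞 F) F) ?_))
  rw [Units.val_pow_eq_pow_val, map_pow, hr, hq]

lemma IsGenPair.coe_pow (g : IsGenPair e O a b) (k : ℕ) :
    (((b ^ k : (↥O)ˣ) : ↥O) : ℍ[F, -e, -3]) = quatEta e ^ k := by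
  rw [Units.val_pow_eq_pow_val, Subring.coe_pow, g.right]

lemma IsGenPair.mul_self (g : IsGenPair e O a b) : redMk O a * redMk O a = 1 := by
  rw [← map_mul, redMk_eq_one, Units.val_mul, Subring.coe_mul, g.left, quatI_mul_self]
  exact ⟨-e, by simp⟩

lemma IsGenPair.redMk_eq_pow (g : IsGenPair e O a b) {x : (↥O)ˣ}
    (hx : ∃ k : ℕ, ((x : ↥O) : ℍ[F, -e, -3]) = quatEta e ^ k) :
    redMk O x ∈ Subgroup.zpowers (redMk O b) := by
  obtain ⟨k, hk⟩ := hx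
  have : x = b ^ k := Units.ext (Subtype.ext (by rw [hk, g.coe_pow]))
  rw [this, map_pow]
  exact Subgroup.npow_mem_zpowers _ _

lemma OverOrder.exists_normOne (h : OverOrder σ₀ σ₁ ε e O) (g : IsGenPair e O a b)
    (q : (↥O)ˣ ⧸ scalarUnits O) :
    ∃ x : (↥O)ˣ, redNorm F ((x : ↥O) : ℍ[F, -e, -3]) = 1 ∧
      (q = redMk O x ∨ q * redMk O a = redMk O x) := by
  obtain ⟨u, rfl⟩ := redMk_surjective q
  obtain ⟨n, hn⟩ := h.isOrder.exists_redNorm_eq u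
  obtain ⟨r, hr⟩ := h.data.eq_sq_or n
    (hn ▸ redNorm_pos h.neg₀ (map_neg_three_lt σ₀) (coe_unit_ne_zero u))
  have hr0 : algebraMap (𝓞 F) F r ≠ 0 := by simp
  rcases hr with hr | hr
  · have hN : redNorm F (algebraMap F _ (algebraMap (𝓞 F) F r)⁻¹ *
        ((u : ↥O) : ℍ[F, -e, -3])) = 1 := by
      rw [redNorm_mul, redNorm_algebraMap, hn, hr]
      rw [Units.val_pow_eq_pow_val, map_pow]
      field_simp
    obtain ⟨x, hx⟩ := h.isOrder.exists_unit_of_redNorm_eq_one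
      (mul_mem (h.isOrder.unit_inv_mem r) (u : ↥O).2) hN
    exact ⟨x, by rw [hx, hN], Or.inl (redMk_eq_of_mul hx).symm⟩
  · have hN : redNorm F (algebraMap F _ (e⁻¹ * (algebraMap (𝓞 F) F r)⁻¹) *
        (((u * a : (↥O)ˣ) : ↥O) : ℍ[F, -e, -3])) = 1 := by
      rw [Units.val_mul, Subring.coe_mul, g.left, redNorm_mul, redNorm_mul, redNorm_algebraMap, hn,
        hr, redNorm_quatI]
      rw [Units.val_mul, Units.val_pow_eq_pow_val, map_mul, map_pow, h.eq]
      have := h.ne_zero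
      field_simp
    obtain ⟨x, hx⟩ := h.isOrder.exists_unit_of_redNorm_eq_one
      (mul_mem (by rw [map_mul]; exact mul_mem h.algebraMap_inv_mem (h.isOrder.unit_inv_mem r))
        ((u * a : (↥O)ˣ) : ↥O).2) hN
    exact ⟨x, by rw [hx, hN], Or.inr (by rw [← map_mul]; exact (redMk_eq_of_mul hx).symm)⟩

variable [CharZero F]

lemma OverOrder.exists_isGenPair (h : OverOrder σ₀ σ₁ ε e O) : ∃ a b, IsGenPair e O a b := by
  obtain ⟨a, ha⟩ := h.isOrder.exists_unit h.quatI_mem (n := ε) (by rw [redNorm_quatI, h.eq])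
  obtain ⟨b, hb⟩ := h.isOrder.exists_unit_of_redNorm_eq_one h.quatEta_mem redNorm_quatEta
  exact ⟨a, b, ha, hb⟩

lemma IsGenPair.pow_three (g : IsGenPair e O a b) : redMk O b ^ 3 = 1 := by
  rw [← map_pow, redMk_eq_one, g.coe_pow, quatEta_pow_three]
  exact ⟨-1, by simp⟩

lemma IsGenPair.conj (g : IsGenPair e O a b) :
    redMk O a * redMk O b * redMk O a = (redMk O b)⁻¹ := by
  rw [eq_inv_iff_mul_eq_one]
  simp only [← map_mul]
  rw [redMk_eq_one]
  simp only [Units.val_mul, Subring.coe_mul, g.left, g.right]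
  refine ⟨-e, ?_⟩
  rw [quatI_mul_quatEta, mul_assoc (1 - quatEta e) (quatI e), quatI_mul_self, mul_assoc, map_neg,
    neg_mul, Algebra.commutes, mul_neg, ← mul_assoc, sub_mul, quatEta_mul_self]
  simp

lemma IsGenPair.orderOf (g : IsGenPair e O a b) : orderOf (redMk O b) = 3 := by
  refine orderOf_eq_prime g.pow_three fun h => ?_
  rw [redMk_eq_one, g.right] at h
  obtain ⟨r, hr⟩ := h
  have := congrArg QuaternionAlgebra.imJ hr
  simp [QuaternionAlgebra.algebraMap_eq] at this

/-- Every unit of norm one is a power of `(1 + j) / 2`: the reduced unit group is `D₃`. -/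
theorem OverOrder.dihedral_three (h : OverOrder σ₀ σ₁ ε e O)
    (hx : ∀ x ∈ O, redNorm F x = 1 → ∃ k : ℕ, x = quatEta e ^ k) :
    RedUnitDihedralSecondKind F 3 O := by
  obtain ⟨a, b, g⟩ := h.exists_isGenPair
  have hbij : Function.Bijective
      (dihedralHom 3 (redMk O b) (redMk O a) g.pow_three g.mul_self g.conj) := by
    refine ⟨dihedralHom_injective _ _ _ g.orderOf
      (notMem_zpowers_of_commute g.orderOf g.mul_self g.conj (Commute.refl _)),
      dihedralHom_surjective _ _ _ fun q => ?_⟩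
    obtain ⟨x, hN, hq⟩ := h.exists_normOne g q
    have := g.redMk_eq_pow (hx _ (x : ↥O).2 hN)
    rcases hq with hq | hq
    · left; rwa [hq]
    · right; rwa [hq]
  obtain ⟨φ, hs, hφ⟩ := h.isOrder.redUnitIso_of_mulEquiv (MulEquiv.ofBijective _ hbij).symm
  refine ⟨φ, hs, hφ, a, ?_, ?_, ?_⟩
  · rw [ne_eq, h.isOrder.redUnit_map_eq_one_iff hφ, g.left]
    rintro ⟨r, hr⟩
    have := congrArg QuaternionAlgebra.imI hr
    simp [QuaternionAlgebra.algebraMap_eq] at this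
  · rw [← map_mul, h.isOrder.redUnit_map_eq_one_iff hφ, ← redMk_eq_one, map_mul, g.mul_self]
  · intro u hu r hr
    have h1 : φ (u * a⁻¹) = 1 := by rw [map_mul, hu, map_inv, mul_inv_cancel]
    obtain ⟨q, hq⟩ := (hφ _).1 h1
    have h2 : ((u : ↥O) : ℍ[F, -e, -3]) = algebraMap F _ (algebraMap (𝓞 F) F q) * quatI e := by
      rw [← hq, ← g.left, ← Subring.coe_mul, ← Units.val_mul, inv_mul_cancel_right]
    rw [h2, redNorm_mul, redNorm_algebraMap, redNorm_quatI, ← h.eq] at hr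
    have hq0 : algebraMap (𝓞 F) F q ≠ 0 := by simp
    refine h.data.ne_sq_field (algebraMap (𝓞 F) F r / algebraMap (𝓞 F) F q) ?_
    rw [div_pow, ← hr]
    field_simp

/-- An element of norm one in `F(j)i` makes the reduced unit group dihedral of order twelve. -/
theorem OverOrder.dihedral_six (h : OverOrder σ₀ σ₁ ε e O) {z : ℍ[F, -e, -3]} (hz : z ∈ O)
    (hzN : redNorm F z = 1) (h0 : z.re = 0) (h2 : z.imJ = 0) :
    RedUnitIso F O (DihedralGroup 6) := by
  obtain ⟨a, b, g⟩ := h.exists_isGenPair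
  obtain ⟨w, rfl⟩ := h.isOrder.exists_unit_of_redNorm_eq_one hz hzN
  obtain ⟨m, hm⟩ : ∃ m : ℕ, redMk O (w * a) * redMk O (w * a) = redMk O b ^ m := by
    have hwN : redNorm F (algebraMap F _ e⁻¹ *
        (((w * a * (w * a) : (↥O)ˣ) : ↥O) : ℍ[F, -e, -3])) = 1 := by
      simp only [Units.val_mul, Subring.coe_mul, g.left, redNorm_mul, redNorm_algebraMap, hzN,
        redNorm_quatI]
      have := h.ne_zero
      field_simp
    have hmem := mul_mem h.algebraMap_inv_mem ((w * a * (w * a) : (↥O)ˣ) : ↥O).2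
    obtain ⟨k, hk⟩ := h.eq_quatEta_pow hmem hwN
      (by simp [g.left, h0, h2, QuaternionAlgebra.algebraMap_eq])
      (by simp [g.left, h0, h2, QuaternionAlgebra.algebraMap_eq])
    refine ⟨k, ?_⟩
    rw [← map_mul, ← map_pow]
    symm
    apply redMk_eq_of_mul (r := e⁻¹)
    rw [g.coe_pow, ← hk]
  refine h.isOrder.redUnitIso_of_mulEquiv (nonempty_mulEquiv_dihedral_six g.orderOf g.mul_self
    g.conj (p := redMk O (w * a)) ?_ ?_ hm ?_ ?_).some
  · rw [commute_iff_eq, ← map_mul, ← map_mul]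
    apply congrArg
    apply Units.ext; apply Subtype.ext
    simp only [Units.val_mul, Subring.coe_mul, g.left, g.right]
    ext <;> simp [h0, h2] <;> ring
  · rw [eq_inv_iff_mul_eq_one]
    simp only [← map_mul]
    rw [redMk_eq_one]
    refine ⟨-e ^ 2, ?_⟩
    simp only [Units.val_mul, Subring.coe_mul, g.left]
    rw [redNorm_eq, h0, h2] at hzN
    ext <;> simp [h0, h2, QuaternionAlgebra.algebraMap_eq]
    · linear_combination (-e ^ 2) * hzN
    · ring
  · rw [← map_pow, ← map_mul, ne_eq, redMk_eq_one]
    rintro ⟨q, hq⟩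
    have h1 := congrArg (redNorm F) hq
    have hb (k : ℕ) : redNorm F (quatEta e ^ k) = 1 := by
      induction k with
      | zero => rw [pow_zero, redNorm_one]
      | succ k ih => rw [pow_succ, redNorm_mul, ih, redNorm_quatEta, one_mul]
    rw [Units.val_mul, Units.val_mul, Subring.coe_mul, Subring.coe_mul, g.coe_pow, redNorm_mul,
      redNorm_mul, hzN, g.left, redNorm_quatI, hb, redNorm_algebraMap, one_mul, mul_one] at h1
    exact h.data.ne_sq_field q (h.eq.trans h1)
  · intro q
    obtain ⟨x, hN, hq⟩ := h.exists_normOne g q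
    refine ⟨redMk O x, hq, ?_⟩
    rcases h.trichotomy (x : ↥O).2 hN with ⟨x0, x2⟩ | h1 | hk
    · right
      have : redMk O x * redMk O a * (redMk O (w * a))⁻¹ = redMk O (x * w⁻¹) := by
        rw [map_mul, map_mul, map_inv]; group
      rw [this]
      refine g.redMk_eq_pow (h.eq_quatEta_pow (((x * w⁻¹ : (↥O)ˣ) : ↥O)).2 ?_ ?_ ?_)
      · rw [Units.val_mul, Subring.coe_mul, coe_inv_eq_star hzN, redNorm_mul, redNorm_star,
          hN, hzN, one_mul]
      · rw [Units.val_mul, Subring.coe_mul, coe_inv_eq_star hzN]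
        simp [x0, x2, h0, h2]
      · rw [Units.val_mul, Subring.coe_mul, coe_inv_eq_star hzN]
        simp [x0, x2, h0, h2]
    · exact (h.not_both (x : ↥O).2 hN h1 hz hzN h0 h2).elim
    · left; exact g.redMk_eq_pow hk

lemma IsGenPair.mem_zpowers_or (g : IsGenPair e O a b) {x : (↥O)ˣ}
    (hx : redMk O x ∈ (dihedralHom 3 (redMk O b) (redMk O a) g.pow_three g.mul_self g.conj).range) :
    normRe ((x : ↥O) : ℍ[F, -e, -3]) = 0 ∨ normIm ((x : ↥O) : ℍ[F, -e, -3]) = 0 := by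
  have key (k : ℤ) : ∃ m : ℕ, redMk O b ^ k = redMk O (b ^ m) := by
    refine ⟨(k % 3).toNat, ?_⟩
    rw [map_pow, ← zpow_natCast, Int.toNat_of_nonneg (Int.emod_nonneg _ (by norm_num))]
    exact (zpow_mod_orderOf _ k).symm.trans (by rw [g.orderOf]; rfl)
  obtain ⟨i | i, hi⟩ := hx
  · obtain ⟨k, rfl⟩ := ZMod.intCast_surjective i
    rw [dihedralHom_r_intCast] at hi
    obtain ⟨m, hm⟩ := key k
    obtain ⟨r, hr⟩ := exists_eq_of_redMk_eq (hi.symm.trans hm)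
    right
    rw [hr, g.coe_pow, normIm]
    simp [quatEta_pow_imI_imK]
  · obtain ⟨k, rfl⟩ := ZMod.intCast_surjective i
    rw [dihedralHom_sr_intCast] at hi
    obtain ⟨m, hm⟩ := key k
    rw [hm, ← map_mul] at hi
    obtain ⟨r, hr⟩ := exists_eq_of_redMk_eq hi.symm
    left
    rw [hr, Units.val_mul, Subring.coe_mul, g.left, g.coe_pow, normRe]
    simp [quatEta_pow_imI_imK]

/-- An element of norm one whose `F(j)`-component has norm `1 / 3` makes the reduced unit group
isomorphic to `S₄`. -/
theorem OverOrder.perm_four (h : OverOrder σ₀ σ₁ ε e O) {y : ℍ[F, -e, -3]} (hy : y ∈ O)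
    (hyN : redNorm F y = 1) (hy1 : 3 * normRe y = 1) :
    RedUnitIso F O (Equiv.Perm (Fin 4)) := by
  obtain ⟨a, b, g⟩ := h.exists_isGenPair
  obtain ⟨y, rfl⟩ := h.isOrder.exists_unit_of_redNorm_eq_one hy hyN
  have hyR : normRe ((y : ↥O) : ℍ[F, -e, -3]) = 1 / 3 := by linear_combination hy1 / 3
  have hyI : normIm ((y : ↥O) : ℍ[F, -e, -3]) = 2 / 3 := by
    have := redNorm_eq_add ((y : ↥O) : ℍ[F, -e, -3])
    linear_combination hyN - this - hyR
  have hbN : redNorm F ((b : ↥O) : ℍ[F, -e, -3]) = 1 := by rw [g.right, redNorm_quatEta]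
  have hnot {x : (↥O)ˣ} (hxN : redNorm F ((x : ↥O) : ℍ[F, -e, -3]) = 1)
      (hx : 3 * normRe ((x : ↥O) : ℍ[F, -e, -3]) = 1) : redMk O x ∉
        (dihedralHom 3 (redMk O b) (redMk O a) g.pow_three g.mul_self g.conj).range := by
    intro hmem
    have h1 := redNorm_eq_add ((x : ↥O) : ℍ[F, -e, -3])
    rw [hxN] at h1
    rcases g.mem_zpowers_or hmem with h2 | h2
    · rw [h2] at hx; norm_num at hx
    · rw [h2, add_zero] at h1
      rw [← h1] at hx; norm_num at hx
  refine h.isOrder.redUnitIso_of_mulEquiv (nonempty_mulEquiv_perm_four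
    (dihedralHom 3 (redMk O b) (redMk O a) g.pow_three g.mul_self g.conj)
    (dihedralHom_injective _ _ _ g.orderOf (notMem_zpowers_of_commute g.orderOf g.mul_self g.conj
      (Commute.refl _))) (redMk O y) (hnot hyN hy1) ?_ fun q => ?_).some
  · rw [dihedralHom_r_one, ← map_inv, ← map_mul, ← map_mul]
    have hval : (((y⁻¹ * b * y : (↥O)ˣ) : ↥O) : ℍ[F, -e, -3]) =
        star ((y : ↥O) : ℍ[F, -e, -3]) * quatEta e * ((y : ↥O) : ℍ[F, -e, -3]) := by
      rw [Units.val_mul, Units.val_mul, Subring.coe_mul, Subring.coe_mul, coe_inv_eq_star hyN,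
        g.right]
    refine hnot ?_ ?_
    · rw [hval, redNorm_mul, redNorm_mul, redNorm_star, hyN, redNorm_quatEta, one_mul, one_mul]
    · rw [hval, normRe_conj, hyR, hyI]; norm_num
  · obtain ⟨x, hxN, hq⟩ := h.exists_normOne g q
    have hs : redMk O a ∈
        (dihedralHom 3 (redMk O b) (redMk O a) g.pow_three g.mul_self g.conj).range :=
      ⟨.sr 0, dihedralHom_sr_zero _ _ _⟩
    have hzp {q : (↥O)ˣ ⧸ scalarUnits O} (hq : q ∈ Subgroup.zpowers (redMk O b)) : q ∈
        (dihedralHom 3 (redMk O b) (redMk O a) g.pow_three g.mul_self g.conj).range := by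
      obtain ⟨k, rfl⟩ := hq
      exact ⟨.r k, dihedralHom_r_intCast _ _ _ _⟩
    have hred {p : (↥O)ˣ ⧸ scalarUnits O} (hp : p * redMk O x ∈
        (dihedralHom 3 (redMk O b) (redMk O a) g.pow_three g.mul_self g.conj).range) : p * q ∈
        (dihedralHom 3 (redMk O b) (redMk O a) g.pow_three g.mul_self g.conj).range := by
      rcases hq with rfl | hq
      · exact hp
      · rwa [← hq, ← mul_assoc, Subgroup.mul_mem_cancel_right _ hs] at hp
    have hsum := normRe_sum ((x : ↥O) : ℍ[F, -e, -3]) ((y : ↥O) : ℍ[F, -e, -3])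
    have hcase (k : ℕ) : 3 * normRe (star ((y : ↥O) : ℍ[F, -e, -3]) *
        (star (quatEta e) ^ k * ((x : ↥O) : ℍ[F, -e, -3]))) = 1 ∨
        ∃ k : ZMod 3, (dihedralHom 3 (redMk O b) (redMk O a) g.pow_three g.mul_self g.conj
          (.r k) * redMk O y)⁻¹ * q ∈
          (dihedralHom 3 (redMk O b) (redMk O a) g.pow_three g.mul_self g.conj).range := by
      have hbkN : redNorm F (((b ^ k : (↥O)ˣ) : ↥O) : ℍ[F, -e, -3]) = 1 := by
        rw [g.coe_pow]
        induction k with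
        | zero => rw [pow_zero, redNorm_one]
        | succ k ih => rw [pow_succ, redNorm_mul, ih, redNorm_quatEta, one_mul]
      have hval : (((y⁻¹ * ((b ^ k)⁻¹ * x) : (↥O)ˣ) : ↥O) : ℍ[F, -e, -3]) =
          star ((y : ↥O) : ℍ[F, -e, -3]) * (star (quatEta e) ^ k *
            ((x : ↥O) : ℍ[F, -e, -3])) := by
        rw [Units.val_mul, Units.val_mul, Subring.coe_mul, Subring.coe_mul, coe_inv_eq_star hyN,
          coe_inv_eq_star hbkN, g.coe_pow, star_pow]
      have hN : redNorm F (((y⁻¹ * ((b ^ k)⁻¹ * x) : (↥O)ˣ) : ↥O) : ℍ[F, -e, -3]) = 1 := by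
        rw [Units.val_mul, Units.val_mul, Subring.coe_mul, Subring.coe_mul, coe_inv_eq_star hyN,
          coe_inv_eq_star hbkN, redNorm_mul, redNorm_mul, redNorm_star, redNorm_star, hyN, hbkN,
          hxN, one_mul, one_mul]
      rw [← hval]
      rcases h.trichotomy (((y⁻¹ * ((b ^ k)⁻¹ * x) : (↥O)ˣ) : ↥O)).2 hN with ⟨h0, h2⟩ | h1 | h3
      · exact (h.not_both (y : ↥O).2 hyN hy1 (((y⁻¹ * ((b ^ k)⁻¹ * x) : (↥O)ˣ) : ↥O)).2 hN h0
          h2).elim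
      · exact Or.inl h1
      · refine Or.inr ⟨((k : ℤ) : ZMod 3), hred ?_⟩
        rw [dihedralHom_r_intCast, zpow_natCast, ← map_pow, ← map_mul, ← map_inv, ← map_mul,
          mul_inv_rev, mul_assoc]
        exact hzp (g.redMk_eq_pow h3)
    rcases h.trichotomy (x : ↥O).2 hxN with ⟨h0, h2⟩ | h1 | h3
    · exact (h.not_both (y : ↥O).2 hyN hy1 (x : ↥O).2 hxN h0 h2).elim
    · right
      by_contra hno
      have e0 := (hcase 0).resolve_right hno
      have e1 := (hcase 1).resolve_right hno
      have e2 := (hcase 2).resolve_right hno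
      rw [pow_zero, one_mul] at e0
      rw [pow_one] at e1
      rw [sq, mul_assoc] at e2
      have hxR : normRe ((x : ↥O) : ℍ[F, -e, -3]) = 1 / 3 := by linear_combination h1 / 3
      have hxI : normIm ((x : ↥O) : ℍ[F, -e, -3]) = 2 / 3 := by
        have := redNorm_eq_add ((x : ↥O) : ℍ[F, -e, -3])
        linear_combination hxN - this - hxR
      rw [hxR, hxI, hyR, hyI] at hsum
      have : (3 : F) = 5 := by linear_combination 3 * hsum - e0 - e1 - e2
      norm_num at this
    · left
      have := hred (p := 1) (by rw [one_mul]; exact hzp (g.redMk_eq_pow h3))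
      rwa [one_mul] at this

/-- The reduced unit group of an order containing `i` and `(1 + j) / 2` is `D₃` (of the second
kind), `S₄` or `D₆`. -/
theorem OverOrder.classification (h : OverOrder σ₀ σ₁ ε e O) :
    RedUnitDihedralSecondKind F 3 O ∨ RedUnitIso F O (Equiv.Perm (Fin 4)) ∨
      RedUnitIso F O (DihedralGroup 6) := by
  by_cases hz : ∃ z ∈ O, redNorm F z = 1 ∧ z.re = 0 ∧ z.imJ = 0
  · obtain ⟨z, hz, hN, h0, h2⟩ := hz
    exact Or.inr (Or.inr (h.dihedral_six hz hN h0 h2))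
  by_cases hy : ∃ y ∈ O, redNorm F y = 1 ∧ 3 * normRe y = 1
  · obtain ⟨y, hy, hN, h1⟩ := hy
    exact Or.inr (Or.inl (h.perm_four hy hN h1))
  push Not at hz hy
  refine Or.inl (h.dihedral_three fun x hx hN => ?_)
  rcases h.trichotomy hx hN with ⟨h0, h2⟩ | h1 | h3
  · exact (hz x hx hN h0 h2).elim
  · exact (hy x hx hN h1).elim
  · exact h3

end Classification

section Conjugation

variable {F : Type} [Field F] [CharZero F] {e : F} {σ : F →+* ℝ}

lemma exists_unit_coe_eq (he : 0 < σ e) {x : ℍ[F, -e, -3]} (hx : x ≠ 0) :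
    ∃ u : ℍ[F, -e, -3]ˣ, (u : ℍ[F, -e, -3]) = x := by
  have hN : redNorm F x ≠ 0 := fun h => hx (eq_zero_of_redNorm_eq_zero (σ := σ)
    (by rwa [map_neg, neg_lt_zero]) (map_neg_three_lt σ) h)
  refine ⟨⟨x, star x * algebraMap F _ (redNorm F x)⁻¹, ?_, ?_⟩, rfl⟩
  · rw [← mul_assoc, mul_star_eq, ← map_mul, mul_inv_cancel₀ hN, map_one]
  · rw [mul_assoc, Algebra.commutes, ← mul_assoc, star_mul_eq, ← map_mul, mul_inv_cancel₀ hN,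
      map_one]

/-- Every pair is conjugate to the standard pair. -/
theorem IsPair.exists_conj (he : 0 < σ e) {v w : ℍ[F, -e, -3]}
    (hp : IsPair (algebraMap F _ e) v w) :
    ∃ x : ℍ[F, -e, -3]ˣ, (x : ℍ[F, -e, -3]) * quatI e = v * x ∧
      (x : ℍ[F, -e, -3]) * quatEta e = w * x := by
  have he0 : e ≠ 0 := by rintro rfl; simp at he
  have hi0 : quatI e ≠ 0 := fun h => by simpa using congrArg QuaternionAlgebra.imI h
  obtain ⟨g, hg⟩ : ∃ g : ℍ[F, -e, -3]ˣ, (g : ℍ[F, -e, -3]) * quatEta e = w * g := by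
    by_cases h : quatEta e + w - 1 = 0
    · obtain ⟨g, hg⟩ := exists_unit_coe_eq he hi0
      refine ⟨g, ?_⟩
      rw [hg, quatI_mul_quatEta]
      congr 1
      exact (sub_eq_zero.1 (by rw [← h]; abel)).symm
    · obtain ⟨g, hg⟩ := exists_unit_coe_eq he h
      refine ⟨g, ?_⟩
      rw [hg, sub_mul, add_mul, mul_sub, mul_add, quatEta_mul_self, hp.sq]
      noncomm_ring
  obtain ⟨v', hv'⟩ : ∃ v', v * g = g * v' := ⟨(g⁻¹ : ℍ[F, -e, -3]ˣ) * v * g, by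
    rw [← mul_assoc, ← mul_assoc, Units.mul_inv, one_mul]⟩
  have hv'2 : v' * v' = -algebraMap F _ e := by
    rw [← Units.mul_right_inj g]
    rw [← mul_assoc, ← hv', mul_assoc, ← hv', ← mul_assoc, hp.mul_self, mul_neg, neg_mul,
      Algebra.commutes]
  have hv'η : v' * quatEta e = (1 - quatEta e) * v' := by
    rw [← Units.mul_right_inj g]
    rw [← mul_assoc, ← hv', mul_assoc, hg, ← mul_assoc, hp.mul_comm, mul_assoc, hv', ← mul_assoc,
      ← mul_assoc, mul_sub, hg, mul_one, sub_mul, one_mul]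
  obtain ⟨h, h1, h2⟩ : ∃ h : ℍ[F, -e, -3]ˣ, (h : ℍ[F, -e, -3]) * quatI e = v' * h ∧
      (h : ℍ[F, -e, -3]) * quatEta e = quatEta e * h := by
    by_cases h0 : algebraMap F _ e - v' * quatI e = 0
    · have hv'i : v' = -quatI e := by
        obtain ⟨u, hu⟩ := exists_unit_coe_eq he hi0
        rw [← Units.mul_left_inj u]
        rw [hu, ← sub_eq_zero.1 h0, neg_mul, quatI_mul_self, neg_neg]
      have hj0 : 2 * quatEta e - 1 ≠ 0 := fun h => by
        simpa [two_mul] using congrArg QuaternionAlgebra.imJ h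
      obtain ⟨h, hh⟩ := exists_unit_coe_eq he hj0
      refine ⟨h, ?_, ?_⟩
      · rw [hh, hv'i, neg_mul, mul_sub, show quatI e * (2 * quatEta e) = 2 * (quatI e * quatEta e)
          by noncomm_ring, quatI_mul_quatEta]
        noncomm_ring
      · rw [hh]; noncomm_ring
    · obtain ⟨h, hh⟩ := exists_unit_coe_eq he h0
      refine ⟨h, ?_, ?_⟩
      · rw [hh, sub_mul, mul_sub, mul_assoc, quatI_mul_self, ← mul_assoc, hv'2,
          ← Algebra.commutes e v', mul_neg, neg_mul, ← Algebra.commutes e v']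
        abel
      · rw [hh, sub_mul, mul_sub, mul_assoc, quatI_mul_quatEta, ← mul_assoc, mul_sub, hv'η,
          Algebra.commutes, mul_one]
        noncomm_ring
  refine ⟨g * h, ?_, ?_⟩
  · rw [Units.val_mul, mul_assoc, h1, ← mul_assoc, ← hv', mul_assoc]
  · rw [Units.val_mul, mul_assoc, h2, ← mul_assoc, hg, mul_assoc]

end Conjugation

section PairsInOrder

variable {F : Type} [Field F] {e : F} {σ₀ σ₁ : F →+* ℝ} {ε : (𝓞 F)ˣ}
  {O : Subring ℍ[F, -e, -3]}

lemma IsPair.one_sub {H : Type} [Ring H] {c v w : H} (hp : IsPair c v w) :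
    IsPair c v (1 - w) := by
  obtain ⟨h1, h2, h3⟩ := hp
  refine ⟨h1, ?_, ?_⟩
  · rw [mul_sub, sub_mul, sub_mul, h2]; noncomm_ring
  · rw [mul_sub, h3]; noncomm_ring

lemma star_eq_one_sub {w : ℍ[F, -e, -3]} (hw : 2 * w.re = 1) : star w = 1 - w := by
  rw [star_eq, hw, map_one]

lemma OverOrder.pos₀ (h : OverOrder σ₀ σ₁ ε e O) : 0 < σ₀ e := h.eq ▸ h.data.pos

variable [CharZero F]

lemma re_and_redNorm_of_mul_self (σ : F →+* ℝ) {w : ℍ[F, -e, -3]} (hw : w * w = w - 1) :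
    2 * w.re = 1 ∧ redNorm F w = 1 := by
  have hns : ¬IsScalar w := by
    rintro ⟨r, rfl⟩
    rw [← map_mul, ← map_one (algebraMap F ℍ[F, -e, -3]), ← map_sub] at hw
    have h1 := congrArg σ ((algebraMap F ℍ[F, -e, -3]).injective hw)
    rw [map_mul, map_sub, map_one] at h1
    nlinarith [sq_nonneg (2 * σ r - 1)]
  have h1 := sub_eq_zero.2 (hw.symm.trans (mul_self_eq w))
  have h2 : algebraMap F _ (1 - 2 * w.re) * w = algebraMap F _ (1 - redNorm F w) := by
    rw [map_sub, map_sub, sub_mul, map_one, one_mul, ← sub_eq_zero, ← h1]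
    abel
  have h3 : 1 - 2 * w.re = 0 := by
    by_contra h
    refine hns ⟨(1 - 2 * w.re)⁻¹ * (1 - redNorm F w), ?_⟩
    rw [map_mul, ← h2, ← mul_assoc, ← map_mul, inv_mul_cancel₀ h, map_one, one_mul]
  rw [h3, map_zero, zero_mul, eq_comm,
    map_eq_zero_iff _ (algebraMap F ℍ[F, -e, -3]).injective] at h2
  exact ⟨(sub_eq_zero.1 h3).symm, (sub_eq_zero.1 h2).symm⟩

lemma eq_one_of_re_eq_one (he : 0 < σ₀ e) {x : ℍ[F, -e, -3]} (h : x.re = 1)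
    (hN : redNorm F x = 1) : x = 1 := by
  rw [← sub_eq_zero]
  apply eq_zero_of_redNorm_eq_zero (σ := σ₀) (by rwa [map_neg, neg_lt_zero]) (map_neg_three_lt σ₀)
  rw [redNorm_eq] at hN ⊢
  simp
  linear_combination hN - 2 * h

/-- Elements of order six whose product with `(1 + j) / 2` has trace one or two are conjugate to
`(1 + j) / 2` within the order. -/
lemma OverOrder.exists_conj_of_trace (h : OverOrder σ₀ σ₁ ε e O) {w : ℍ[F, -e, -3]} (hw : w ∈ O)
    (hww : w * w = w - 1)
    (hs : 2 * (quatEta e * w).re = 1 ∨ 2 * (quatEta e * w).re = 2) :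
    ∃ g ∈ O, redNorm F g = 1 ∧ (g * quatEta e = w * g ∨ g * quatEta e = (1 - w) * g) := by
  obtain ⟨hr, hN⟩ := re_and_redNorm_of_mul_self σ₀ hww
  have hη : 2 * (quatEta e).re = 1 := by simp
  rcases hs with hs | hs
  · refine ⟨quatEta e + w - 1, sub_mem (add_mem h.quatEta_mem hw) (one_mem _), ?_, Or.inl ?_⟩
    · have h1 : (quatEta e * w).re = 2⁻¹ := by linear_combination hs / 2
      have h2 : w.re = 2⁻¹ := by linear_combination hr / 2
      simp only [redNorm_eq] at hN ⊢
      simp [h2] at hN h1 ⊢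
      linear_combination hN - 2 * h1
    · rw [sub_mul, add_mul, mul_sub, mul_add, quatEta_mul_self, hww]
      noncomm_ring
  · refine ⟨1, one_mem _, redNorm_one, Or.inr ?_⟩
    have h1 : quatEta e * w = 1 := eq_one_of_re_eq_one h.pos₀ (by linear_combination hs / 2)
      (by rw [redNorm_mul, hN, redNorm_quatEta, one_mul])
    rw [one_mul, mul_one, ← star_eq_one_sub hr]
    have h2 : w * star w = 1 := by rw [mul_star_eq, hN, map_one]
    exact left_inv_eq_right_inv h1 h2

lemma OverOrder.exists_conj_quatEta (h : OverOrder σ₀ σ₁ ε e O) {w : ℍ[F, -e, -3]} (hw : w ∈ O)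
    (hww : w * w = w - 1) :
    ∃ g ∈ O, redNorm F g = 1 ∧ (g * quatEta e = w * g ∨ g * quatEta e = (1 - w) * g) := by
  obtain ⟨hr, hN⟩ := re_and_redNorm_of_mul_self σ₀ hww
  have hw' : 1 - w ∈ O := sub_mem (one_mem _) hw
  have hww' : (1 - w) * (1 - w) = (1 - w) - 1 := by
    rw [mul_sub, sub_mul, sub_mul, hww]; noncomm_ring
  obtain ⟨hr', hN'⟩ := re_and_redNorm_of_mul_self σ₀ hww'
  obtain ⟨m, hm, -, hm2⟩ := h.exists_trace_eq (mul_mem h.quatEta_mem hw)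
    (by rw [redNorm_mul, redNorm_quatEta, hN, one_mul])
  obtain ⟨n, hn, -, hn2⟩ := h.exists_trace_eq (mul_mem h.quatEta_mem hw')
    (by rw [redNorm_mul, redNorm_quatEta, hN', one_mul])
  have hmn : (m : F) + n = 1 := by
    rw [← hm, ← hn, mul_sub, mul_one, QuaternionAlgebra.re_sub, quatEta_re]
    ring_nf
  have hmn' : m + n = 1 := by exact_mod_cast hmn
  by_cases hm1 : 1 ≤ m
  · refine h.exists_conj_of_trace hw hww ?_
    rw [hm]
    rcases (by omega : m = 1 ∨ m = 2) with rfl | rfl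
    · left; norm_num
    · right; norm_num
  · obtain ⟨g, hg, hgN, hgw⟩ := h.exists_conj_of_trace hw' hww' (by
      rw [hn]
      rcases (by omega : n = 1 ∨ n = 2) with rfl | rfl
      · left; norm_num
      · right; norm_num)
    refine ⟨g, hg, hgN, ?_⟩
    rw [sub_sub_cancel] at hgw
    exact hgw.symm

/-- Within an order, every pair is conjugate to a pair generating the same order as the standard
pair. -/
theorem OverOrder.exists_conj_pair (h : OverOrder σ₀ σ₁ ε e O) {v w : ℍ[F, -e, -3]} (hv : v ∈ O)
    (hw : w ∈ O) (hp : IsPair (algebraMap F _ e) v w) :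
    ∃ g ∈ O, redNorm F g = 1 ∧ (∃ k : ℕ, g * (quatEta e ^ k * quatI e) = v * g) ∧
      (g * quatEta e = w * g ∨ g * quatEta e = (1 - w) * g) := by
  obtain ⟨g, hg, hgN, hgw⟩ := h.exists_conj_quatEta hw hp.sq
  refine ⟨g, hg, hgN, ?_, hgw⟩
  obtain ⟨w', hp', hgw'⟩ : ∃ w', IsPair (algebraMap F _ e) v w' ∧ g * quatEta e = w' * g := by
    rcases hgw with h1 | h1
    · exact ⟨w, hp, h1⟩
    · exact ⟨1 - w, hp.one_sub, h1⟩
  have hg1 : g * star g = 1 := by rw [mul_star_eq, hgN, map_one]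
  have hg2 : star g * g = 1 := by rw [star_mul_eq, hgN, map_one]
  have hmem : star g * v * g ∈ O := mul_mem (mul_mem (h.isOrder.star_mem hg) hv) hg
  have hvg : g * (star g * v * g) = v * g := by rw [← mul_assoc, ← mul_assoc, hg1, one_mul]
  have hcomm : star g * v * g * quatEta e = (1 - quatEta e) * (star g * v * g) := by
    have h1 : star g * w' = quatEta e * star g := by
      rw [← mul_one (star g * w'), ← hg1, ← mul_assoc, mul_assoc (star g), ← hgw', ← mul_assoc,
        hg2, one_mul]
    rw [mul_assoc _ g, hgw', ← mul_assoc, mul_assoc (star g), hp'.mul_comm, sub_mul 1 (quatEta e),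
      ← mul_assoc, mul_sub, h1]
    noncomm_ring
  generalize star g * v * g = v' at hmem hvg hcomm
  have hsq : v' * v' = -algebraMap F _ e := by
    have h1 : g * (v' * v') = g * -algebraMap F _ e := by
      rw [← mul_assoc, hvg, mul_assoc, hvg, ← mul_assoc, hp.mul_self, mul_neg, neg_mul,
        Algebra.commutes]
    rw [← one_mul (v' * v'), ← hg2, mul_assoc, h1, ← mul_assoc, hg2, one_mul]
  have h0 : v'.re = 0 ∧ v'.imJ = 0 := by
    have h1 := congrArg QuaternionAlgebra.re hcomm
    have h2 := congrArg QuaternionAlgebra.imJ hcomm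
    simp at h1 h2
    field_simp at h1 h2
    constructor
    · linear_combination h2 / 2
    · linear_combination -h1 / 6
  have hN : redNorm F v' = e := by
    have h1 := mul_self_eq v'
    rw [hsq, h0.1, mul_zero, map_zero, zero_mul, zero_sub, neg_inj] at h1
    exact ((algebraMap F ℍ[F, -e, -3]).injective h1).symm
  have hκ : algebraMap F _ e⁻¹ * (v' * -quatI e) ∈ O :=
    mul_mem h.algebraMap_inv_mem (mul_mem hmem (neg_mem h.quatI_mem))
  have hinv : e⁻¹ * e = 1 := inv_mul_cancel₀ h.ne_zero
  obtain ⟨k, hk⟩ := h.eq_quatEta_pow hκ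
    (by
      rw [redNorm_mul, redNorm_mul, redNorm_algebraMap, hN]
      rw [show redNorm F (-quatI e) = e by simp [redNorm_eq]]
      linear_combination (e⁻¹ * e + 1) * hinv)
    (by simp [h0.1, h0.2, QuaternionAlgebra.algebraMap_eq])
    (by simp [h0.1, h0.2, QuaternionAlgebra.algebraMap_eq])
  refine ⟨k, ?_⟩
  rw [← hvg, ← hk, mul_assoc (algebraMap F _ e⁻¹), mul_assoc v', neg_mul, quatI_mul_self, neg_neg,
    ← Algebra.commutes, ← mul_assoc (algebraMap F _ e⁻¹), ← map_mul, hinv, map_one, one_mul]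

end PairsInOrder

section ConjugateOrders

variable {H : Type} [Ring H] {O O' O'' : Subring H} {x y : Hˣ}

lemma IsConjugate.refl (O : Subring H) : IsConjugate 1 O O := fun y => by simp

lemma IsConjugate.symm (h : IsConjugate x O O') : IsConjugate x⁻¹ O' O := fun y => by
  rw [h, inv_inv]
  simp [mul_assoc]

lemma IsConjugate.trans (h : IsConjugate x O O') (h' : IsConjugate y O' O'') :
    IsConjugate (y * x) O O'' := fun z => by
  rw [h, h', mul_inv_rev]
  simp [mul_assoc]

/-- Conjugacy of subrings, as an equivalence relation. -/
def conjSetoid (H : Type) [Ring H] : Setoid (Subring H) where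
  r := ConjRel
  iseqv := ⟨fun O => ⟨1, .refl O⟩, fun ⟨x, h⟩ => ⟨x⁻¹, h.symm⟩,
    fun ⟨x, h⟩ ⟨y, h'⟩ => ⟨y * x, h.trans h'⟩⟩

/-- The conjugacy class of a subring. -/
def conjClass (O : Subring H) : Quotient (conjSetoid H) := Quotient.mk _ O

lemma conjClass_eq : conjClass O = conjClass O' ↔ ConjRel O O' :=
  Quotient.eq (r := conjSetoid H)

/-- The isomorphism between conjugate subrings. -/
def IsConjugate.ringEquiv (h : IsConjugate x O O') : O ≃+* O' where
  toFun y := ⟨x * y * (x⁻¹ : Hˣ), (h y).1 y.2⟩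
  invFun y := ⟨(x⁻¹ : Hˣ) * y * x, (h _).2 (by simp [mul_assoc])⟩
  left_inv y := by ext; simp [mul_assoc]
  right_inv y := by ext; simp [mul_assoc]
  map_mul' y z := by ext; simp [mul_assoc]
  map_add' y z := by ext; simp [mul_add, add_mul]

variable {F : Type} [Field F] [Algebra F H]

lemma IsConjugate.isScalarUnit_iff (h : IsConjugate x O O') (u : (↥O)ˣ) :
    IsScalarUnit F (Units.mapEquiv (h.ringEquiv : O ≃* O') u) ↔ IsScalarUnit F u := by
  have (r : (𝓞 F)ˣ) : (x : H) * ((u : ↥O) : H) * ((x⁻¹ : Hˣ) : H) =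
      algebraMap F H (algebraMap (𝓞 F) F r) ↔
      ((u : ↥O) : H) = algebraMap F H (algebraMap (𝓞 F) F r) := by
    rw [Units.mul_inv_eq_iff_eq_mul, Algebra.commutes, Units.mul_right_inj]
  exact exists_congr this

lemma RedUnitIso.of_conjRel {G : Type*} [Group G] (h : ConjRel O O') (hO : RedUnitIso F O G) :
    RedUnitIso F O' G := by
  obtain ⟨x, h⟩ := h
  obtain ⟨φ, hs, hφ⟩ := hO
  refine ⟨φ.comp (Units.mapEquiv (h.ringEquiv : O ≃* O')).symm.toMonoidHom,
    hs.comp (Units.mapEquiv (h.ringEquiv : O ≃* O')).symm.surjective, fun u => ?_⟩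
  change φ ((Units.mapEquiv (h.ringEquiv : O ≃* O')).symm u) = 1 ↔ _
  rw [hφ, ← h.isScalarUnit_iff, MulEquiv.apply_symm_apply]

lemma RedUnitIso.natCard_eq {G G' : Type*} [Group G] [Group G'] (h : RedUnitIso F O G)
    (h' : RedUnitIso F O G') : Nat.card G = Nat.card G' := by
  obtain ⟨φ, hs, hφ⟩ := h
  obtain ⟨ψ, ht, hψ⟩ := h'
  have hk : φ.ker = ψ.ker := by
    ext u
    rw [MonoidHom.mem_ker, MonoidHom.mem_ker, hφ, hψ]
  have h1 := Subgroup.index_ker φ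
  have h2 := Subgroup.index_ker ψ
  rw [φ.range_eq_top.2 hs, Subgroup.card_top] at h1
  rw [ψ.range_eq_top.2 ht, Subgroup.card_top] at h2
  rw [← h1, ← h2, hk]

/-- Conjugation by a unit. -/
def conjEquiv (F : Type) [Field F] [Algebra F H] (x : Hˣ) : H ≃ₐ[F] H :=
  AlgEquiv.ofRingEquiv (f :=
    { toFun := fun y => x * y * (x⁻¹ : Hˣ)
      invFun := fun y => (x⁻¹ : Hˣ) * y * x
      left_inv := fun y => by simp [mul_assoc]
      right_inv := fun y => by simp [mul_assoc]
      map_mul' := fun y z => by simp [mul_assoc]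
      map_add' := fun y z => by simp [mul_add, add_mul] }) fun r => by
    change (x : H) * algebraMap F H r * ((x⁻¹ : Hˣ) : H) = _
    rw [← Algebra.commutes, mul_assoc, Units.mul_inv, mul_one]

lemma conjEquiv_apply (y : H) : conjEquiv F x y = x * y * (x⁻¹ : Hˣ) := rfl

lemma IsOrder.map (hO : IsOrder F O) (f : H ≃ₐ[F] H) :
    IsOrder F (O.map (f : H →+* H)) := by
  refine ⟨?_, ?_, ?_⟩
  · rintro _ ⟨r, rfl⟩
    exact ⟨_, hO.1 ⟨r, rfl⟩, f.commutes _⟩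
  · have := hO.2.1
    rw [AddSubgroup.fg_iff_addSubmonoid_fg] at this ⊢
    exact this.map (f : H →+* H).toAddMonoidHom
  · have h1 : ((O.map (f : H →+* H) : Subring H) : Set H) = f.toLinearMap '' (O : Set H) := rfl
    rw [h1, Submodule.span_image, hO.2.2, Submodule.map_top]
    exact LinearMap.range_eq_top.2 f.surjective

lemma IsMaximalOrder.map (hO : IsMaximalOrder F O) (f : H ≃ₐ[F] H) :
    IsMaximalOrder F (O.map (f : H →+* H)) := by
  refine ⟨hO.1.map f, fun O' hO' hle => le_antisymm (fun y hy => ?_) hle⟩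
  have h1 := hO.2 _ (hO'.map f.symm) fun z hz => ⟨f z, hle ⟨z, hz, rfl⟩, f.symm_apply_apply z⟩
  have h2 : f.symm y ∈ O := by
    rw [← h1]
    exact ⟨y, hy, rfl⟩
  exact ⟨_, h2, f.apply_symm_apply y⟩

lemma isConjugate_map (x : Hˣ) (O : Subring H) :
    IsConjugate x O (O.map (conjEquiv F x : H →+* H)) := fun y => by
  constructor
  · exact fun hy => ⟨y, hy, rfl⟩
  · rintro ⟨z, hz, h⟩
    rwa [← (conjEquiv F x).injective h]

end ConjugateOrders

section StandardOrder

variable {F : Type} [Field F] {e : F} {O : Subring ℍ[F, -e, -3]}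

/-- The order with basis `1, i, (1 + j) / 2, (i + k) / 2`. -/
def standardOrder (e : F) : Subring ℍ[F, -e, -3] :=
  Subring.closure (scalarSet F ℍ[F, -e, -3] ∪ {quatI e, quatEta e})

lemma scalarSet_subset_standardOrder : scalarSet F ℍ[F, -e, -3] ⊆ standardOrder e :=
  Set.subset_union_left.trans Subring.subset_closure

lemma quatI_mem_standardOrder : quatI e ∈ standardOrder e :=
  Subring.subset_closure (Or.inr (Or.inl rfl))

lemma quatEta_mem_standardOrder : quatEta e ∈ standardOrder e :=
  Subring.subset_closure (Or.inr (Or.inr rfl))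

lemma standardOrder_le (hO : IsOrder F O) (hi : quatI e ∈ O) (hη : quatEta e ∈ O) :
    standardOrder e ≤ O := by
  rw [standardOrder, Subring.closure_le]
  rintro x (hx | rfl | rfl)
  · exact hO.1 hx
  · exact hi
  · exact hη

lemma conj_mem_standardOrder {x : ℍ[F, -e, -3]ˣ}
    (hi : (x : ℍ[F, -e, -3]) * quatI e * (x⁻¹ : ℍ[F, -e, -3]ˣ) ∈ standardOrder e)
    (hη : (x : ℍ[F, -e, -3]) * quatEta e * (x⁻¹ : ℍ[F, -e, -3]ˣ) ∈ standardOrder e)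
    {y : ℍ[F, -e, -3]} (hy : y ∈ standardOrder e) :
    (x : ℍ[F, -e, -3]) * y * (x⁻¹ : ℍ[F, -e, -3]ˣ) ∈ standardOrder e := by
  have : standardOrder e ≤
      (standardOrder e).comap (conjEquiv F x : ℍ[F, -e, -3] →+* ℍ[F, -e, -3]) := by
    conv_lhs => rw [standardOrder]
    rw [Subring.closure_le]
    rintro y (⟨r, rfl⟩ | rfl | rfl)
    · change conjEquiv F x _ ∈ standardOrder e
      rw [AlgEquiv.commutes]
      exact scalarSet_subset_standardOrder ⟨r, rfl⟩
    · exact hi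
    · exact hη
  exact this hy

variable [CharZero F]

lemma quatEta_mul_one_sub : quatEta e * (1 - quatEta e) = 1 := by
  rw [mul_sub, quatEta_mul_self]; noncomm_ring

/-- A unit which permutes the powers of the generators normalizes the standard order. -/
lemma isConjugate_standardOrder {z : ℍ[F, -e, -3]ˣ} {k : ℕ}
    (h1 : (z : ℍ[F, -e, -3]) * quatI e = quatEta e ^ k * quatI e * z)
    (h2 : (z : ℍ[F, -e, -3]) * quatEta e = quatEta e * z ∨
      (z : ℍ[F, -e, -3]) * quatEta e = (1 - quatEta e) * z) :
    IsConjugate z (standardOrder e) (standardOrder e) := by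
  have hη' : 1 - quatEta e ∈ standardOrder e := sub_mem (one_mem _) quatEta_mem_standardOrder
  have hinv : (z⁻¹ : ℍ[F, -e, -3]ˣ) * quatEta e * z = quatEta e ∨
      (z⁻¹ : ℍ[F, -e, -3]ˣ) * quatEta e * z = 1 - quatEta e := by
    rcases h2 with h2 | h2
    · left; rw [mul_assoc, ← h2, Units.inv_mul_cancel_left]
    · right
      have h3 : quatEta e * (z : ℍ[F, -e, -3]) = z * (1 - quatEta e) := by
        rw [mul_sub, h2]; noncomm_ring
      rw [mul_assoc, h3, Units.inv_mul_cancel_left]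
  have hcomm : quatEta e * (1 - quatEta e) = (1 - quatEta e) * quatEta e := by noncomm_ring
  have hconj (x : ℍ[F, -e, -3]) (m : ℕ) :
      (z⁻¹ : ℍ[F, -e, -3]ˣ) * x ^ m * z = ((z⁻¹ : ℍ[F, -e, -3]ˣ) * x * z) ^ m := by
    have := map_pow (conjEquiv F z⁻¹) x m
    simpa only [conjEquiv_apply, inv_inv] using this
  have hηinv : (z⁻¹ : ℍ[F, -e, -3]ˣ) * quatEta e * z ∈ standardOrder e := by
    rcases hinv with h | h
    · rw [h]; exact quatEta_mem_standardOrder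
    · rw [h]; exact hη'
  intro y
  refine ⟨fun hy => conj_mem_standardOrder ?_ ?_ hy, fun hy => ?_⟩
  · rw [h1, Units.mul_inv_cancel_right]
    exact mul_mem (pow_mem quatEta_mem_standardOrder _) quatI_mem_standardOrder
  · rcases h2 with h2 | h2
    · rw [h2, Units.mul_inv_cancel_right]
      exact quatEta_mem_standardOrder
    · rwa [h2, Units.mul_inv_cancel_right]
  · have := conj_mem_standardOrder (x := z⁻¹) ?_ ?_ hy
    · rw [inv_inv] at this
      simpa [mul_assoc] using this
    · rw [inv_inv]
      have h3 : quatI e = (1 - quatEta e) ^ k * (quatEta e ^ k * quatI e) := by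
        rw [← mul_assoc, ← (show Commute _ _ from hcomm).symm.mul_pow, ← hcomm,
          quatEta_mul_one_sub, one_pow, one_mul]
      have h4 : (z⁻¹ : ℍ[F, -e, -3]ˣ) * quatI e * z =
          (1 - (z⁻¹ : ℍ[F, -e, -3]ˣ) * quatEta e * z) ^ k * quatI e := by
        have h5 : (1 : ℍ[F, -e, -3]) - (z⁻¹ : ℍ[F, -e, -3]ˣ) * quatEta e * z =
            (z⁻¹ : ℍ[F, -e, -3]ˣ) * (1 - quatEta e) * z := by
          rw [mul_sub, sub_mul, mul_one, Units.inv_mul]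
        rw [h5, ← hconj]
        conv_lhs => rw [h3]
        rw [mul_assoc, mul_assoc ((1 - quatEta e) ^ k), ← h1, mul_assoc _ (z : ℍ[F, -e, -3]),
          mul_assoc _ ((1 - quatEta e) ^ k)]
      rw [h4]
      exact mul_mem (pow_mem (sub_mem (one_mem _) hηinv) _) quatI_mem_standardOrder
    · rwa [inv_inv]

variable {σ₀ σ₁ : F →+* ℝ} {ε : (𝓞 F)ˣ} {O' : Subring ℍ[F, -e, -3]}

/-- Conjugate orders containing the standard order are conjugate under its normalizer. -/
theorem OverOrder.exists_normalizer (h : OverOrder σ₀ σ₁ ε e O) (h' : OverOrder σ₀ σ₁ ε e O')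
    (hc : ConjRel O O') :
    ∃ z : ℍ[F, -e, -3]ˣ, IsConjugate z (standardOrder e) (standardOrder e) ∧
      IsConjugate z O O' := by
  obtain ⟨x, hx⟩ := hc
  have hp : IsPair (algebraMap F _ e) (conjEquiv F x (quatI e)) (conjEquiv F x (quatEta e)) := by
    obtain ⟨h1, h2, h3⟩ := isPair_standard (e := e)
    refine ⟨?_, ?_, ?_⟩
    · rw [← map_mul, h1, map_neg, AlgEquiv.commutes]
    · rw [← map_mul, h2, map_sub, map_one]
    · rw [← map_mul, h3, map_mul, map_sub, map_one]
  obtain ⟨g, hg, hgN, ⟨k, hk⟩, hgw⟩ := h'.exists_conj_pair ((hx _).1 h.quatI_mem)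
    ((hx _).1 h.quatEta_mem) hp
  obtain ⟨u, rfl⟩ := h'.isOrder.exists_unit_of_redNorm_eq_one hg hgN
  obtain ⟨g, hgu⟩ : ∃ g : ℍ[F, -e, -3]ˣ, g = Units.map O'.subtype.toMonoidHom u := ⟨_, rfl⟩
  have hg1 : ((u : ↥O') : ℍ[F, -e, -3]) = g := by rw [hgu]; rfl
  have hg2 : (((u⁻¹ : (↥O')ˣ) : ↥O') : ℍ[F, -e, -3]) = (g⁻¹ : ℍ[F, -e, -3]ˣ) := by
    rw [hgu, ← map_inv]; rfl
  have hgc : IsConjugate g O' O' := by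
    have hm : (g : ℍ[F, -e, -3]) ∈ O' := hg1 ▸ (u : ↥O').2
    have hm' : ((g⁻¹ : ℍ[F, -e, -3]ˣ) : ℍ[F, -e, -3]) ∈ O' := hg2 ▸ ((u⁻¹ : (↥O')ˣ) : ↥O').2
    intro y
    refine ⟨fun hy => mul_mem (mul_mem hm hy) hm', fun hy => ?_⟩
    have := mul_mem (mul_mem hm' hy) hm
    simpa [mul_assoc] using this
  rw [hg1] at hk hgw
  have key {y t : ℍ[F, -e, -3]} (hy : g * t = x * y * (x⁻¹ : ℍ[F, -e, -3]ˣ) * g) :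
      ((g⁻¹ * x : ℍ[F, -e, -3]ˣ) : ℍ[F, -e, -3]) * y = t * (g⁻¹ * x : ℍ[F, -e, -3]ˣ) := by
    rw [Units.val_mul, mul_assoc, Units.inv_mul_eq_iff_eq_mul, ← mul_assoc, ← mul_assoc, hy]
    simp [mul_assoc]
  refine ⟨g⁻¹ * x, isConjugate_standardOrder (key hk) ?_, hx.trans hgc.symm⟩
  refine hgw.imp (fun h1 => key h1) fun h1 => key ?_
  rw [mul_sub, h1, mul_one]
  noncomm_ring

/-- An order containing a pair is conjugate to an order containing the standard order. -/
theorem IsMaximalOrder.exists_conjRel (he : 0 < σ₀ e) (hO : IsMaximalOrder F O)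
    {v w : ℍ[F, -e, -3]} (hv : v ∈ O) (hw : w ∈ O) (hp : IsPair (algebraMap F _ e) v w) :
    ∃ O', IsMaximalOrder F O' ∧ standardOrder e ≤ O' ∧ ConjRel O' O := by
  obtain ⟨x, h1, h2⟩ := hp.exists_conj he
  have hc := isConjugate_map (F := F) x⁻¹ O
  have hmem {y t : ℍ[F, -e, -3]} (ht : t ∈ O) (h : (x : ℍ[F, -e, -3]) * y = t * x) :
      y ∈ O.map (conjEquiv F x⁻¹ : ℍ[F, -e, -3] →+* ℍ[F, -e, -3]) := by
    refine ⟨t, ht, ?_⟩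
    change (x⁻¹ : ℍ[F, -e, -3]ˣ) * t * (x⁻¹⁻¹ : ℍ[F, -e, -3]ˣ) = y
    rw [inv_inv, mul_assoc, ← h, Units.inv_mul_cancel_left]
  have hm := hO.map (conjEquiv F x⁻¹)
  exact ⟨_, hm, standardOrder_le hm.1 (hmem hv h1) (hmem hw h2), x⁻¹⁻¹, hc.symm⟩

end StandardOrder

section Finiteness

variable {F : Type} [Field F] [NumberField F] {e : F} {ε : (𝓞 F)ˣ}
  {O O' : Subring ℍ[F, -e, -3]}

/-- The quaternion with coordinates `a / 6` in the basis `1, i, j, k`. -/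
def quatSixth (e : F) (a : Fin 4 → 𝓞 F) : ℍ[F, -e, -3] :=
  ⟨algebraMap (𝓞 F) F (a 0) / 6, algebraMap (𝓞 F) F (a 1) / 6, algebraMap (𝓞 F) F (a 2) / 6,
    algebraMap (𝓞 F) F (a 3) / 6⟩

lemma IsOrder.exists_quatSixth (hO : IsOrder F O) (he : algebraMap (𝓞 F) F ε = e)
    (hle : standardOrder e ≤ O) {x : ℍ[F, -e, -3]} (hx : x ∈ O) : ∃ a, quatSixth e a = x := by
  have hi := hle quatI_mem_standardOrder
  have hη := hle quatEta_mem_standardOrder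
  have hj : 2 * quatEta e - 1 ∈ O := sub_mem (mul_mem (ofNat_mem O 2) hη) (one_mem _)
  have hinv : algebraMap F ℍ[F, -e, -3] e⁻¹ ∈ O := he ▸ hO.unit_inv_mem ε
  have he0 : e ≠ 0 := by rw [← he]; simp
  have int3 : IsIntegral ℤ (3 : F) := by
    simpa using isIntegral_algebraMap (R := ℤ) (A := F) (x := 3)
  have h0 := (hO.trace_integral hx).mul int3
  have h1 := (hO.trace_integral (mul_mem hinv (mul_mem hx hi))).mul int3
  have h2 := hO.trace_integral (mul_mem hx hj)
  have h3 := hO.trace_integral (mul_mem hinv (mul_mem hx (mul_mem hi hj)))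
  rw [re_algebraMap_mul] at h1 h3
  have h1' : 2 * (e⁻¹ * (x * quatI e).re) * 3 = -(6 * x.imI) := by
    simp; field_simp; ring
  have h2' : 2 * (x * (2 * quatEta e - 1)).re = -(6 * x.imJ) := by
    simp [two_mul]; field_simp; ring
  have h3' : 2 * (e⁻¹ * (x * (quatI e * (2 * quatEta e - 1))).re) = -(6 * x.imK) := by
    simp [two_mul]; field_simp; ring
  rw [h1', IsIntegral.neg_iff] at h1
  rw [h2', IsIntegral.neg_iff] at h2
  rw [h3', IsIntegral.neg_iff] at h3
  refine ⟨![⟨_, h0⟩, ⟨_, h1⟩, ⟨_, h2⟩, ⟨_, h3⟩], ?_⟩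
  ext
  · change 2 * x.re * 3 / 6 = x.re
    field_simp; ring
  · change 6 * x.imI / 6 = x.imI
    field_simp
  · change 6 * x.imJ / 6 = x.imJ
    field_simp
  · change 6 * x.imK / 6 = x.imK
    field_simp

lemma quatSixth_sub_mem {a b : Fin 4 → 𝓞 F}
    (h : ∀ i, a i - b i ∈ Ideal.span {(6 : 𝓞 F)}) :
    quatSixth e a - quatSixth e b ∈ standardOrder e := by
  choose c hc using fun i => Ideal.mem_span_singleton'.1 (h i)
  have hs (r : 𝓞 F) : algebraMap F ℍ[F, -e, -3] (algebraMap (𝓞 F) F r) ∈ standardOrder e :=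
    scalarSet_subset_standardOrder ⟨r, rfl⟩
  have hj : 2 * quatEta e - 1 ∈ standardOrder e :=
    sub_mem (mul_mem (ofNat_mem _ 2) quatEta_mem_standardOrder) (one_mem _)
  have hi : quatI e ∈ standardOrder e := quatI_mem_standardOrder
  have key : quatSixth e a - quatSixth e b = algebraMap F _ (algebraMap (𝓞 F) F (c 0)) +
      algebraMap F _ (algebraMap (𝓞 F) F (c 1)) * quatI e +
      algebraMap F _ (algebraMap (𝓞 F) F (c 2)) * (2 * quatEta e - 1) +
      algebraMap F _ (algebraMap (𝓞 F) F (c 3)) * (quatI e * (2 * quatEta e - 1)) := by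
    have hc' (i : Fin 4) : algebraMap (𝓞 F) F (a i) =
        algebraMap (𝓞 F) F (c i) * 6 + algebraMap (𝓞 F) F (b i) := by
      rw [← sub_eq_iff_eq_add, ← map_sub, ← hc i, map_mul, map_ofNat]
    ext <;> simp [quatSixth, hc', two_mul, QuaternionAlgebra.algebraMap_eq] <;> field_simp <;> ring
  rw [key]
  exact add_mem (add_mem (add_mem (hs _) (mul_mem (hs _) hi)) (mul_mem (hs _) hj))
    (mul_mem (hs _) (mul_mem hi hj))

/-- Finitely many orders contain the standard order. -/
theorem finite_overOrders (he : algebraMap (𝓞 F) F ε = e) :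
    {O : Subring ℍ[F, -e, -3] | IsOrder F O ∧ standardOrder e ≤ O}.Finite := by
  have : Finite (𝓞 F ⧸ Ideal.span {(6 : 𝓞 F)}) :=
    Ideal.finiteQuotientOfFreeOfNeBot _ (by simp)
  let q : (Fin 4 → 𝓞 F) → Fin 4 → 𝓞 F ⧸ Ideal.span {(6 : 𝓞 F)} := fun a i =>
    Ideal.Quotient.mk _ (a i)
  let f : Subring ℍ[F, -e, -3] → Set (Fin 4 → 𝓞 F ⧸ Ideal.span {(6 : 𝓞 F)}) := fun O =>
    q '' {a | quatSixth e a ∈ O}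
  have key {O O' : Subring ℍ[F, -e, -3]} (hO : IsOrder F O ∧ standardOrder e ≤ O)
      (hO' : IsOrder F O' ∧ standardOrder e ≤ O') (h : f O = f O') : O ≤ O' := by
    intro x hx
    obtain ⟨a, rfl⟩ := hO.1.exists_quatSixth he hO.2 hx
    obtain ⟨b, hb, hab⟩ : q a ∈ f O' := h ▸ ⟨a, hx, rfl⟩
    have h1 : quatSixth e a - quatSixth e b ∈ standardOrder e :=
      quatSixth_sub_mem fun i => Ideal.Quotient.eq.1 (congrFun hab i).symm
    simpa using add_mem (hO'.2 h1) hb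
  refine Set.Finite.of_finite_image (f := f) (Set.toFinite _) fun O hO O' hO' h => ?_
  exact le_antisymm (key hO hO' h) (key hO' hO h.symm)

end Finiteness

section Counting

lemma natCard_quot_eq_ncard_image {α T : Type*} {p : α → Prop} {r : {a // p a} → {a // p a} → Prop}
    (c : α → T) (h : ∀ a b, r a b ↔ c a = c b) :
    Nat.card (Quot r) = (c '' {a | p a}).ncard := by
  rw [← Nat.card_coe_set_eq]
  refine Nat.card_congr (Equiv.ofBijective
    (Quot.lift (fun a => ⟨c a, a, a.2, rfl⟩) fun a b hab => Subtype.ext ((h a b).1 hab)) ⟨?_, ?_⟩)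
  · rintro ⟨a⟩ ⟨b⟩ hab
    exact Quot.sound ((h a b).2 (congrArg Subtype.val hab))
  · rintro ⟨_, a, ha, rfl⟩
    exact ⟨Quot.mk _ ⟨a, ha⟩, rfl⟩

lemma disjoint_image_conjClass {H : Type} [Ring H] {p q : Subring H → Prop}
    (h : ∀ O O', p O → q O' → ¬ConjRel O O') :
    Disjoint (conjClass '' {O | p O}) (conjClass '' {O | q O}) := by
  rw [Set.disjoint_left]
  rintro _ ⟨O, hO, rfl⟩ ⟨O', hO', h'⟩
  exact h O O' hO hO' (conjClass_eq.1 h'.symm)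

lemma RedUnitDihedralSecondKind.redUnitIso {F : Type} [Field F] {A B : F} {n : ℕ}
    {O : Subring ℍ[F, A, B]}
    (h : RedUnitDihedralSecondKind F n O) : RedUnitIso F O (DihedralGroup n) :=
  let ⟨φ, hs, hφ, _⟩ := h
  ⟨φ, hs, hφ⟩

variable {F : Type} [Field F] [NumberField F] {σ₀ σ₁ : F →+* ℝ} {ε : (𝓞 F)ˣ}

/-- The maximal orders with reduced unit group `D₃` of the second kind, `S₄` or `D₆` are counted by
the maximal orders containing the standard order, up to its normalizer. -/
theorem SmallUnitData.sum_typeNum_eq (D : SmallUnitData σ₀ σ₁ ε) {e : F}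
    (he : algebraMap (𝓞 F) F ε = e) (h₁ : 0 < σ₁ e) :
    typeNumDnSecondKind F (-e) (-3) 3 + typeNum F ℍ[F, -e, -3] (Equiv.Perm (Fin 4))
      + typeNum F ℍ[F, -e, -3] (DihedralGroup 6) = bethNum F (standardOrder e) := by
  have h₀ : 0 < σ₀ e := he ▸ D.pos
  have hover {O : Subring ℍ[F, -e, -3]} (hO : IsMaximalOrder F O) (hle : standardOrder e ≤ O) :
      OverOrder σ₀ σ₁ ε e O :=
    ⟨D, he, h₁, hO.1, hle quatI_mem_standardOrder, hle quatEta_mem_standardOrder⟩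
  have hA₀ : σ₀ (-e) < 0 := by rwa [map_neg, neg_lt_zero]
  have hA₁ : σ₁ (-e) < 0 := by rwa [map_neg, neg_lt_zero]
  have hB₀ := map_neg_three_lt σ₀
  have hB₁ := map_neg_three_lt σ₁
  have e1 : typeNumDnSecondKind F (-e) (-3) 3 = (conjClass '' {O : Subring ℍ[F, -e, -3] |
      IsMaximalOrder F O ∧ RedUnitDihedralSecondKind F 3 O}).ncard :=
    natCard_quot_eq_ncard_image _ fun O O' => conjClass_eq.symm
  have e2 : typeNum F ℍ[F, -e, -3] (Equiv.Perm (Fin 4)) =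
      (conjClass '' {O : Subring ℍ[F, -e, -3] |
        IsMaximalOrder F O ∧ RedUnitIso F O (Equiv.Perm (Fin 4))}).ncard :=
    natCard_quot_eq_ncard_image _ fun O O' => conjClass_eq.symm
  have e3 : typeNum F ℍ[F, -e, -3] (DihedralGroup 6) = (conjClass '' {O : Subring ℍ[F, -e, -3] |
      IsMaximalOrder F O ∧ RedUnitIso F O (DihedralGroup 6)}).ncard :=
    natCard_quot_eq_ncard_image _ fun O O' => conjClass_eq.symm
  have e4 : bethNum F (standardOrder e) = (conjClass '' {O : Subring ℍ[F, -e, -3] |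
      IsMaximalOrder F O ∧ standardOrder e ≤ O}).ncard := by
    refine natCard_quot_eq_ncard_image _ fun O O' => ?_
    rw [conjClass_eq]
    exact ⟨fun ⟨x, _, hx⟩ => ⟨x, hx⟩,
      (hover O.2.1 O.2.2).exists_normalizer (hover O'.2.1 O'.2.2)⟩
  have hfin : (conjClass '' {O : Subring ℍ[F, -e, -3] |
      IsMaximalOrder F O ∧ standardOrder e ≤ O}).Finite :=
    ((finite_overOrders he).subset fun O hO => ⟨hO.1.1, hO.2⟩).image _
  have hcls {O : Subring ℍ[F, -e, -3]} (hO : IsMaximalOrder F O) (h : 0 < σ₁ (algebraMap (𝓞 F) F ε)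
      ∧ ∃ v w, v ∈ O ∧ w ∈ O ∧ IsPair (algebraMap F ℍ[F, -e, -3] (algebraMap (𝓞 F) F ε)) v w) :
      conjClass O ∈ conjClass '' {O : Subring ℍ[F, -e, -3] |
        IsMaximalOrder F O ∧ standardOrder e ≤ O} := by
    obtain ⟨-, v, w, hv, hw, hp⟩ := h
    rw [he] at hp
    obtain ⟨O', h1, h2, h3⟩ := hO.exists_conjRel h₀ hv hw hp
    exact ⟨O', ⟨h1, h2⟩, conjClass_eq.2 h3⟩
  have hunion : conjClass '' {O : Subring ℍ[F, -e, -3] |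
        IsMaximalOrder F O ∧ standardOrder e ≤ O} =
      conjClass '' {O | IsMaximalOrder F O ∧ RedUnitDihedralSecondKind F 3 O} ∪
      conjClass '' {O | IsMaximalOrder F O ∧ RedUnitIso F O (Equiv.Perm (Fin 4))} ∪
      conjClass '' {O | IsMaximalOrder F O ∧ RedUnitIso F O (DihedralGroup 6)} := by
    apply Set.Subset.antisymm
    · rintro _ ⟨O, ⟨hO, hle⟩, rfl⟩
      rcases (hover hO hle).classification with h | h | h
      · exact Or.inl (Or.inl ⟨O, ⟨hO, h⟩, rfl⟩)
      · exact Or.inl (Or.inr ⟨O, ⟨hO, h⟩, rfl⟩)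
      · exact Or.inr ⟨O, ⟨hO, h⟩, rfl⟩
    · rintro _ ((⟨O, ⟨hO, h⟩, rfl⟩ | ⟨O, ⟨hO, h⟩, rfl⟩) | ⟨O, ⟨hO, h⟩, rfl⟩)
      · exact hcls hO (hO.1.exists_isPair_of_dihedral_three D hA₀ hB₀ hA₁ hB₁ h)
      · exact hcls hO (hO.1.exists_isPair_of_perm_four D hA₀ hB₀ hA₁ hB₁ h)
      · exact hcls hO (hO.1.exists_isPair_of_dihedral_six D hA₀ hB₀ hA₁ hB₁ h)
  have hS : Nat.card (Equiv.Perm (Fin 4)) = 24 := by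
    rw [Nat.card_perm, Nat.card_eq_fintype_card, Fintype.card_fin]; rfl
  have d1 : Disjoint
      (conjClass '' {O : Subring ℍ[F, -e, -3] |
        IsMaximalOrder F O ∧ RedUnitDihedralSecondKind F 3 O})
      (conjClass '' {O | IsMaximalOrder F O ∧ RedUnitIso F O (Equiv.Perm (Fin 4))}) := by
    refine disjoint_image_conjClass fun O O' hO hO' hc => ?_
    have := (hO.2.redUnitIso.of_conjRel hc).natCard_eq hO'.2
    rw [DihedralGroup.nat_card, hS] at this
    omega
  have d2 : Disjoint
      (conjClass '' {O : Subring ℍ[F, -e, -3] |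
        IsMaximalOrder F O ∧ RedUnitDihedralSecondKind F 3 O} ∪
        conjClass '' {O | IsMaximalOrder F O ∧ RedUnitIso F O (Equiv.Perm (Fin 4))})
      (conjClass '' {O | IsMaximalOrder F O ∧ RedUnitIso F O (DihedralGroup 6)}) := by
    refine Set.disjoint_union_left.2 ⟨disjoint_image_conjClass fun O O' hO hO' hc => ?_,
      disjoint_image_conjClass fun O O' hO hO' hc => ?_⟩
    · have := (hO.2.redUnitIso.of_conjRel hc).natCard_eq hO'.2
      rw [DihedralGroup.nat_card, DihedralGroup.nat_card] at this
      omega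
    · have := (hO.2.of_conjRel hc).natCard_eq hO'.2
      rw [hS, DihedralGroup.nat_card] at this
      omega
  rw [hunion] at hfin
  have f3 := hfin.subset Set.subset_union_right
  have f12 := hfin.subset Set.subset_union_left
  rw [e1, e2, e3, e4, hunion, Set.ncard_union_eq d2 f12 f3,
    Set.ncard_union_eq d1 (f12.subset Set.subset_union_left) (f12.subset Set.subset_union_right)]

end Counting

section FundamentalUnitData

variable {F : Type} [Field F] [NumberField F] {d : ℕ} {s : F} {σ₀ σ₁ : F →+* ℝ} {ε : (𝓞 F)ˣ}

lemma IsRealQuadratic.exists_conj_embedding (h : IsRealQuadratic d s) (σ₀ : F →+* ℝ) :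
    ∃ σ₁ : F →+* ℝ, σ₁ s = -σ₀ s := by
  obtain ⟨τ, hτ⟩ := h.exists_conj
  exact ⟨σ₀.comp τ, by rw [RingHom.comp_apply, hτ, map_neg]⟩

lemma IsRealQuadratic.norm_eq (h : IsRealQuadratic d s) (hσ : σ₁ s = -σ₀ s) (x : F) :
    ((Algebra.norm ℚ x : ℚ) : ℝ) = σ₀ x * σ₁ x := by
  obtain ⟨p, q, rfl⟩ := h.exists_rat_pair x
  rw [h.norm_rat_pair]
  have h1 := congrArg σ₀ h.sq_eq
  rw [map_pow, map_natCast] at h1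
  simp only [map_add, map_mul, map_ratCast, hσ]
  push_cast
  linear_combination (q : ℝ) ^ 2 * h1

lemma IsRealQuadratic.smallUnitData (h : IsRealQuadratic d s) (hσ : σ₁ s = -σ₀ s)
    (hε : IsFundamentalUnit σ₀ ε) : SmallUnitData σ₀ σ₁ ε where
  pos := zero_lt_one.trans hε.one_lt
  eq_sq_or _ hu := hε.eq_sq_or hu
  ne_sq := hε.ne_sq
  sq_ne_two x := by
    exact_mod_cast h.sq_ne_natCast 2 Nat.prime_two.squarefree le_rfl (by have := h.six_le; omega) x
  sq_ne_three x := by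
    exact_mod_cast h.sq_ne_natCast 3 Nat.prime_three.squarefree (by norm_num)
      (by have := h.six_le; omega) x
  exists_int_eq _ ht h0 h1 := h.exists_int_eq σ₀ σ₁ hσ ht h0 h1

end FundamentalUnitData

/-- **Type numbers for `D₃‡` via the minimal order `𝒪₃‡ = O_F[i,(1+j)/2] ⊂ (−ε,−3 / F)`** -/
theorem typeNum_D3_second_kind
    (d : ℕ) (hd6 : 6 ≤ d) (hdsf : Squarefree d)
    (sqrtd : F) (hsqrtd : sqrtd ^ 2 = (d : F))
    (hgen : Algebra.adjoin ℚ {sqrtd} = ⊤)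
    (σ₀ : F →+* ℝ) (hσ₀ : 0 < σ₀ sqrtd)
    -- `ε` is the fundamental unit of `F`: the smallest unit greater than `1`
    (ε : (𝓞 F)ˣ) (hε : 1 < σ₀ (algebraMap (𝓞 F) F ↑ε))
    (hεfund : ∀ u : (𝓞 F)ˣ, 1 < σ₀ (algebraMap (𝓞 F) F ↑u) →
      σ₀ (algebraMap (𝓞 F) F ↑ε) ≤ σ₀ (algebraMap (𝓞 F) F ↑u)) :
    -- If `Nm(ε) = 1` and `H = (−ε, −3 / F)`, then
    -- `t(D₃‡) + t(S₄) + t(D₆) = ℶ(𝒪₃‡)`, where `𝒪₃‡ = O_F[i, (1+j)/2]`.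
    (Algebra.norm ℚ (algebraMap (𝓞 F) F ↑ε) = 1 →
      typeNumDnSecondKind F (-(algebraMap (𝓞 F) F ↑ε)) (-3) 3
        + typeNum F ℍ[F, -(algebraMap (𝓞 F) F ↑ε), -3] (Equiv.Perm (Fin 4))
        + typeNum F ℍ[F, -(algebraMap (𝓞 F) F ↑ε), -3] (DihedralGroup 6)
        = bethNum F (Subring.closure
            (scalarSet F ℍ[F, -(algebraMap (𝓞 F) F ↑ε), -3] ∪
              {⟨0, 1, 0, 0⟩,
                (2 : F)⁻¹ •
                  (1 + (⟨0, 0, 1, 0⟩ : ℍ[F, -(algebraMap (𝓞 F) F ↑ε), -3]))}))) ∧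
    -- In all the remaining cases `t(H, D₃‡) = 0` for every totally definite
    -- quaternion `F`-algebra `H = ℍ[F, A, B]`.
    (∀ A B : F, (∀ σ : F →+* ℝ, σ A < 0 ∧ σ B < 0) →
      (Algebra.norm ℚ (algebraMap (𝓞 F) F ↑ε) = -1 ∨
        ¬Nonempty (ℍ[F, A, B] ≃ₐ[F] ℍ[F, -(algebraMap (𝓞 F) F ↑ε), -3])) →
      typeNumDnSecondKind F A B 3 = 0) := by
  have hQ : IsRealQuadratic d sqrtd := ⟨hd6, hdsf, hsqrtd, hgen⟩
  obtain ⟨σ₁, hσ⟩ := hQ.exists_conj_embedding σ₀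
  have D := hQ.smallUnitData hσ ⟨hε, hεfund⟩
  have hnorm := hQ.norm_eq hσ (algebraMap (𝓞 F) F ε)
  refine ⟨fun h => ?_, fun A B hAB h => ?_⟩
  · refine D.sum_typeNum_eq rfl ?_
    rw [h, Rat.cast_one] at hnorm
    exact pos_of_mul_pos_right (hnorm ▸ one_pos) D.pos.le
  · have : IsEmpty {O : Subring ℍ[F, A, B] //
        IsMaximalOrder F O ∧ RedUnitDihedralSecondKind F 3 O} := by
      refine ⟨fun O => ?_⟩
      obtain ⟨h1, v, w, -, -, hp⟩ := O.2.1.1.exists_isPair_of_dihedral_three D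
        (hAB σ₀).1 (hAB σ₀).2 (hAB σ₁).1 (hAB σ₁).2 O.2.2
      rcases h with h | h
      · have := mul_pos D.pos h1
        rw [← hnorm, h] at this
        norm_num at this
      · exact h (hp.nonempty_algEquiv D.pos)
    rw [typeNumDnSecondKind]
    exact Nat.card_of_isEmpty

end QuatPaper
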